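/- arXiv:1808.04148 — 5 statements merged into one kernel-verified Lean document; each statement's English description precedes it below -/
import Mathlib

section
/- Let G be a finite simple graph with a grounded L-representation, and let < be the linear order on the vertices induced by this representation (u < v iff a u < a v). Then (G,<) avoids the pattern P1; that is, there are no vertices x1 < x2 < x3 < x4 such that x1x3 and x2x4 are edges of G while x1x2 and x2x3 are non-edges of G. -/
/-- The grounded L-shape with anchor `(a, 0)`, depth `h` and width `w`:
the union of the vertical segment from `(a, 0)` to `(a, -h)` and the
horizontal segment from `(a, -h)` to `(a + w, -h)`. -/
def LShape (a h w : ℝ) : Set (ℝ × ℝ) :=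
  segment ℝ ((a, 0) : ℝ × ℝ) ((a, -h) : ℝ × ℝ) ∪
    segment ℝ ((a, -h) : ℝ × ℝ) ((a + w, -h) : ℝ × ℝ)

/-- A grounded L-representation of a simple graph `G`. -/
structure GroundedLRep {V : Type} (G : SimpleGraph V) where
  a : V → ℝ
  ht : V → ℝ
  wd : V → ℝ
  ht_pos : ∀ v, 0 < ht v
  wd_pos : ∀ v, 0 < wd v
  a_inj : Function.Injective a
  ht_inj : Function.Injective ht
  endpoint_off : ∀ u v, u ≠ v →
    ((a v + wd v, -ht v) : ℝ × ℝ) ∉ LShape (a u) (ht u) (wd u)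
  adj_iff : ∀ u v, u ≠ v →
    (G.Adj u v ↔ (LShape (a u) (ht u) (wd u) ∩ LShape (a v) (ht v) (wd v)).Nonempty)

/-- Membership in a grounded L-shape in coordinates. -/
theorem mem_LShape_iff {a h w : ℝ} (hh : 0 ≤ h) (hw : 0 ≤ w) (x y : ℝ) :
    (x, y) ∈ LShape a h w ↔
      (x = a ∧ -h ≤ y ∧ y ≤ 0) ∨ (y = -h ∧ a ≤ x ∧ x ≤ a + w) := by
  rw [LShape, ← Prod.image_mk_segment_right, ← Prod.image_mk_segment_left,
    segment_symm, segment_eq_Icc (by linarith), segment_eq_Icc (by linarith)]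
  simp only [Set.mem_union, Set.mem_image, Set.mem_Icc, Prod.mk.injEq]
  grind

/-- Two L-shapes with distinct anchors meet exactly when the horizontal segment of the left one
crosses the vertical segment of the right one. -/
theorem LShape_inter_nonempty_iff {a h w b k z : ℝ} (hh : 0 ≤ h) (hw : 0 ≤ w) (hk : 0 ≤ k)
    (hz : 0 ≤ z) (hab : a < b) :
    (LShape a h w ∩ LShape b k z).Nonempty ↔ b ≤ a + w ∧ h ≤ k := by
  constructor
  · rintro ⟨⟨x, y⟩, hu, hv⟩
    rw [mem_LShape_iff hh hw] at hu
    rw [mem_LShape_iff hk hz] at hv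
    grind
  · rintro ⟨hba, hhk⟩
    refine ⟨(b, -h), ?_, ?_⟩
    · rw [mem_LShape_iff hh hw]
      grind
    · rw [mem_LShape_iff hk hz]
      grind

/-- Adjacency in a grounded L-representation, for vertices ordered by their anchors. -/
theorem GroundedLRep.adj_iff_of_lt {V : Type} {G : SimpleGraph V} (R : GroundedLRep G) {u v : V}
    (huv : R.a u < R.a v) :
    G.Adj u v ↔ R.a v ≤ R.a u + R.wd u ∧ R.ht u ≤ R.ht v := by
  rw [R.adj_iff u v (ne_of_apply_ne R.a huv.ne),
    LShape_inter_nonempty_iff (R.ht_pos u).le (R.wd_pos u).le (R.ht_pos v).le (R.wd_pos v).le huv]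

/-- Any grounded L-representation of a finite simple graph `G`
induces a vertex order avoiding the pattern `P₁`: there are no four vertices
`x₁ < x₂ < x₃ < x₄` (ordered by anchors) with `x₁x₃`, `x₂x₄` edges and
`x₁x₂`, `x₂x₃` non-edges. -/
theorem grounded_L_avoids_P1 {V : Type} [Fintype V] (G : SimpleGraph V)
    (R : GroundedLRep G) :
    ¬ ∃ x1 x2 x3 x4 : V,
        R.a x1 < R.a x2 ∧ R.a x2 < R.a x3 ∧ R.a x3 < R.a x4 ∧
        G.Adj x1 x3 ∧ G.Adj x2 x4 ∧ ¬ G.Adj x1 x2 ∧ ¬ G.Adj x2 x3 := by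
  rintro ⟨x1, x2, x3, x4, h12, h23, h34, e13, e24, n12, n23⟩
  rw [R.adj_iff_of_lt (h12.trans h23)] at e13
  rw [R.adj_iff_of_lt (h23.trans h34)] at e24
  rw [R.adj_iff_of_lt h12] at n12
  rw [R.adj_iff_of_lt h23] at n23
  grind
end

section
/- Let G be a finite simple graph and let < be a linear order on its vertex set such that (G,<) avoids both patterns P1 and P2. Then G has a grounded L-representation whose induced order is exactly <. -/
theorem mem_LShape {a h w : ℝ} (hh : 0 < h) (hw : 0 < w) (p q : ℝ) :
    (p, q) ∈ LShape a h w ↔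
      (p = a ∧ -h ≤ q ∧ q ≤ 0) ∨ (q = -h ∧ a ≤ p ∧ p ≤ a + w) := by
  have h1 : (-h : ℝ) ≤ 0 := by linarith
  have h2 : a ≤ a + w := by linarith
  rw [LShape, Set.mem_union, ← Prod.image_mk_segment_right, ← Prod.image_mk_segment_left,
    segment_symm ℝ (0 : ℝ), segment_eq_Icc h1, segment_eq_Icc h2]
  simp only [Set.mem_image, Set.mem_Icc, Prod.mk.injEq]
  constructor
  · rintro (⟨y, hy, rfl, rfl⟩ | ⟨x, hx, rfl, rfl⟩)
    · exact Or.inl ⟨rfl, hy⟩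
    · exact Or.inr ⟨rfl, hx⟩
  · rintro (⟨rfl, hq⟩ | ⟨rfl, hp⟩)
    · exact Or.inl ⟨q, hq, rfl, rfl⟩
    · exact Or.inr ⟨p, hp, rfl, rfl⟩

theorem LShape_inter_nonempty_iff_s2 {a h w a' h' w' : ℝ} (hh : 0 < h) (hw : 0 < w)
    (hh' : 0 < h') (hw' : 0 < w') (haa : a < a') (hne : h ≠ h') :
    (LShape a h w ∩ LShape a' h' w').Nonempty ↔ h < h' ∧ a' ≤ a + w := by
  constructor
  · rintro ⟨⟨p, q⟩, h1, h2⟩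
    rw [mem_LShape hh hw] at h1
    rw [mem_LShape hh' hw'] at h2
    rcases h1 with ⟨rfl, -, -⟩ | ⟨rfl, -, hp⟩
    · rcases h2 with ⟨rfl, -, -⟩ | ⟨-, h3, -⟩ <;> linarith
    · rcases h2 with ⟨rfl, h3, -⟩ | ⟨h3, -, -⟩
      · exact ⟨lt_of_le_of_ne (by linarith) hne, hp⟩
      · exact absurd (neg_injective h3) hne
  · rintro ⟨h1, h2⟩
    refine ⟨(a', -h), (mem_LShape hh hw _ _).2 (Or.inr ⟨rfl, haa.le, h2⟩),
      (mem_LShape hh' hw' _ _).2 (Or.inl ⟨rfl, ?_, ?_⟩)⟩ <;> linarith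

/-- `DepthLT G u v` holds when every grounded L-representation in which each shape reaches exactly
to its last right neighbour must give `u` a smaller depth than `v`. -/
def DepthLT {V : Type} [LinearOrder V] (G : SimpleGraph V) (u v : V) : Prop :=
  (u < v ∧ G.Adj u v) ∨ (v < u ∧ ¬ G.Adj v u ∧ ∃ w, u < w ∧ G.Adj v w)

/-- The in- and out-neighbours of a vertex `m` exceeding them all are joined by an arc. -/
theorem DepthLT.of_max {V : Type} [LinearOrder V] {G : SimpleGraph V}
    (hP1 : ¬ ∃ x1 x2 x3 x4 : V, x1 < x2 ∧ x2 < x3 ∧ x3 < x4 ∧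
      G.Adj x1 x3 ∧ G.Adj x2 x4 ∧ ¬ G.Adj x1 x2 ∧ ¬ G.Adj x2 x3)
    (hP2 : ¬ ∃ x1 x2 x3 x4 : V, x1 < x2 ∧ x2 < x3 ∧ x3 < x4 ∧
      G.Adj x1 x2 ∧ G.Adj x1 x4 ∧ G.Adj x2 x3 ∧ ¬ G.Adj x1 x3)
    {x y m : V} (hx : x < m) (hy : y < m) (hxm : DepthLT G x m) (hmy : DepthLT G m y) :
    DepthLT G x y := by
  have hxm' : G.Adj x m := by
    rcases hxm with h | h
    · exact h.2
    · exact absurd h.1 hx.not_gt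
  obtain ⟨hmy', w, hmw, hyw⟩ : ¬ G.Adj y m ∧ ∃ w, m < w ∧ G.Adj y w := by
    rcases hmy with h | h
    · exact absurd h.1 hy.not_gt
    · exact h.2
  rcases lt_trichotomy x y with h | rfl | h
  · by_cases hxy : G.Adj x y
    · exact Or.inl ⟨h, hxy⟩
    · exact absurd ⟨x, y, m, w, h, hy, hmw, hxm', hyw, hxy, hmy'⟩ hP1
  · exact absurd hxm' hmy'
  · by_cases hxy : G.Adj y x
    · exact absurd ⟨y, x, m, w, h, hx, hmw, hxy, hyw, hxm', hmy'⟩ hP2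
    · exact Or.inr ⟨h, hxy, w, hx.trans hmw, hyw⟩

theorem DepthLT.irrefl {V : Type} [LinearOrder V] (G : SimpleGraph V) (u : V) :
    ¬ DepthLT G u u := by
  rintro (h | h) <;> exact lt_irrefl _ h.1

/-- If in-neighbours of each maximal vertex always precede its out-neighbours, then a relation
admits an injective positive real potential on every finite set. -/
theorem exists_potential_of_max {V : Type} [LinearOrder V] (D : V → V → Prop)
    (hirr : ∀ u, ¬ D u u)
    (hmax : ∀ x y m, x < m → y < m → D x m → D m y → D x y) (S : Finset V) :
    ∃ h : V → ℝ, (∀ v, 0 < h v) ∧ Set.InjOn h S ∧ ∀ u ∈ S, ∀ v ∈ S, D u v → h u < h v := by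
  classical
  induction S using Finset.induction_on_max with
  | empty => exact ⟨fun _ => 1, by simp, by simp, by simp⟩
  | insert m S hm ih =>
    obtain ⟨h, hpos, hinj, hD⟩ := ih
    have hmS : m ∉ S := fun hmem => lt_irrefl _ (hm m hmem)
    let above : V → Prop := fun s => ∃ y ∈ S, D m y ∧ h y ≤ h s
    obtain ⟨c, hlo, hhi⟩ := Order.exists_between_finsets
      (insert 0 ((S.filter fun s => ¬ above s).image h)) ((S.filter above).image h) (by
        intro x hx z hz
        obtain ⟨t, ht, rfl⟩ := Finset.mem_image.1 hz
        obtain ⟨-, y, hyS, hmy, hyt⟩ := Finset.mem_filter.1 ht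
        rcases Finset.mem_insert.1 hx with rfl | hx
        · exact hpos t
        · obtain ⟨s, hs, rfl⟩ := Finset.mem_image.1 hx
          by_contra! hts
          exact (Finset.mem_filter.1 hs).2 ⟨y, hyS, hmy, hyt.trans hts⟩)
    have hlow : ∀ s ∈ S, ¬ above s → h s < c := fun s hs hab =>
      hlo _ (Finset.mem_insert_of_mem (Finset.mem_image_of_mem h (Finset.mem_filter.2 ⟨hs, hab⟩)))
    have hhigh : ∀ s ∈ S, above s → c < h s := fun s hs hab =>
      hhi _ (Finset.mem_image_of_mem h (Finset.mem_filter.2 ⟨hs, hab⟩))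
    have hne : ∀ s ∈ S, h s ≠ c := fun s hs => by
      by_cases hab : above s
      · exact (hhigh s hs hab).ne'
      · exact (hlow s hs hab).ne
    have hupd : ∀ s ∈ S, Function.update h m c s = h s := fun s hs =>
      Function.update_of_ne (hm s hs).ne _ _
    refine ⟨Function.update h m c, fun v => ?_, ?_, ?_⟩
    · by_cases hv : v = m
      · subst hv
        simpa using hlo 0 (Finset.mem_insert_self _ _)
      · simpa [hv] using hpos v
    · rw [Finset.coe_insert, Set.injOn_insert (by simpa using hmS)]
      refine ⟨hinj.congr fun s hs => (hupd s hs).symm, ?_⟩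
      rintro ⟨s, hs, hsc⟩
      rw [hupd s hs, Function.update_self] at hsc
      exact hne s hs hsc
    · intro u hu v hv huv
      rw [Finset.mem_insert] at hu hv
      rcases hu with rfl | hu <;> rcases hv with rfl | hv
      · exact absurd huv (hirr _)
      · rw [hupd v hv, Function.update_self]
        exact hhigh v hv ⟨v, hv, huv, le_rfl⟩
      · rw [hupd u hu, Function.update_self]
        refine hlow u hu ?_
        rintro ⟨y, hy, hmy, hyu⟩
        exact (hD u hu y hy (hmax u y _ (hm u hu) (hm y hy) huv hmy)).not_ge hyu
      · rw [hupd u hu, hupd v hv]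
        exact hD u hu v hv huv

/-- The largest value of `k` over `u` and its right neighbours. -/
noncomputable def reachIndex {V : Type} [Fintype V] [LinearOrder V] (G : SimpleGraph V)
    (k : V → ℕ) (u : V) : ℕ := by
  classical exact k u ⊔ (Finset.univ.filter fun v => u < v ∧ G.Adj u v).sup k

theorem le_reachIndex_iff {V : Type} [Fintype V] [LinearOrder V] (G : SimpleGraph V)
    {k : V → ℕ} (hk : StrictMono k) {u v : V} (huv : u < v) :
    k v ≤ reachIndex G k u ↔ ∃ w, v ≤ w ∧ G.Adj u w := by
  classical
  have hbot : ⊥ < k v := lt_of_le_of_lt bot_le (hk huv)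
  rw [reachIndex, le_sup_iff, Finset.le_sup_iff hbot]
  simp only [(hk huv).not_ge, false_or, Finset.mem_filter, Finset.mem_univ, true_and, hk.le_iff_le]
  exact ⟨fun ⟨w, hw, hvw⟩ => ⟨w, hvw, hw.2⟩, fun ⟨w, hvw, hw⟩ => ⟨w, ⟨huv.trans_le hvw, hw⟩, hvw⟩⟩

/-- If a linear order on the vertices of a finite simple graph `G`
avoids both patterns `P₁` and `P₂`, then `G` has a grounded L-representation whose
induced order (by anchors) is exactly the given order. -/
theorem grounded_L_of_avoids_P1_P2 {V : Type} [Fintype V] [LinearOrder V]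
    (G : SimpleGraph V)
    (hP1 : ¬ ∃ x1 x2 x3 x4 : V, x1 < x2 ∧ x2 < x3 ∧ x3 < x4 ∧
      G.Adj x1 x3 ∧ G.Adj x2 x4 ∧ ¬ G.Adj x1 x2 ∧ ¬ G.Adj x2 x3)
    (hP2 : ¬ ∃ x1 x2 x3 x4 : V, x1 < x2 ∧ x2 < x3 ∧ x3 < x4 ∧
      G.Adj x1 x2 ∧ G.Adj x1 x4 ∧ G.Adj x2 x3 ∧ ¬ G.Adj x1 x3) :
    ∃ R : GroundedLRep G, ∀ u v : V, u < v ↔ R.a u < R.a v := by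
  classical
  obtain ⟨h, hpos, hinj, hD⟩ := exists_potential_of_max (DepthLT G) (DepthLT.irrefl G)
    (fun _ _ _ hx hy => DepthLT.of_max hP1 hP2 hx hy) Finset.univ
  replace hinj : Function.Injective h := by simpa using hinj
  replace hD : ∀ u v, DepthLT G u v → h u < h v := fun u v =>
    hD u (Finset.mem_univ _) v (Finset.mem_univ _)
  let k : V → ℕ := fun v => (Finset.univ.filter fun u => u < v).card
  have hk : StrictMono k := fun u v huv => by
    refine Finset.card_lt_card ((Finset.ssubset_iff_of_subset fun x hx => ?_).2 ⟨u, ?_, ?_⟩)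
    · simpa using (Finset.mem_filter.1 hx).2.trans huv
    · simpa using huv
    · simp
  let w : V → ℝ := fun v => (reachIndex G k v : ℝ) + 1 / 2 - k v
  have hwpos : ∀ v, 0 < w v := fun v => by
    have : (k v : ℝ) ≤ reachIndex G k v := by
      exact_mod_cast (le_sup_left : k v ≤ reachIndex G k v)
    simp only [w]
    linarith
  have hreach : ∀ u v, (k v : ℝ) ≤ k u + w u ↔ k v ≤ reachIndex G k u := fun u v => by
    simp only [w, add_sub_cancel]
    constructor
    · intro hle
      have : (k v : ℝ) < (reachIndex G k u + 1 : ℕ) := by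
        push_cast
        linarith
      exact Nat.lt_succ_iff.1 (by exact_mod_cast this)
    · intro hle
      have : (k v : ℝ) ≤ reachIndex G k u := by exact_mod_cast hle
      linarith
  have hadj : ∀ u v, u < v → (G.Adj u v ↔
      (LShape (k u) (h u) (w u) ∩ LShape (k v) (h v) (w v)).Nonempty) := fun u v huv => by
    rw [LShape_inter_nonempty_iff_s2 (hpos u) (hwpos u) (hpos v) (hwpos v)
      (by exact_mod_cast hk huv) (hinj.ne huv.ne), hreach, le_reachIndex_iff G hk huv]
    constructor
    · exact fun hG => ⟨hD _ _ (Or.inl ⟨huv, hG⟩), v, le_rfl, hG⟩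
    · rintro ⟨hlt, x, hvx, hux⟩
      by_contra hG
      have hvx' : v < x := lt_of_le_of_ne hvx fun hEq => hG (hEq ▸ hux)
      exact hlt.not_gt (hD _ _ (Or.inr ⟨huv, hG, x, hvx', hux⟩))
  refine ⟨⟨fun v => k v, h, w, hpos, hwpos, fun u v huv => hk.injective (Nat.cast_injective huv),
    hinj, fun u v huv hmem => ?_, fun u v huv => ?_⟩, fun u v => ?_⟩
  · rcases (mem_LShape (hpos u) (hwpos u) _ _).1 hmem with ⟨hEq, -⟩ | ⟨hEq, -⟩
    · have h2 : (2 * reachIndex G k v + 1 : ℝ) = 2 * k u := by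
        simp only [w] at hEq
        linarith
      have h3 : 2 * reachIndex G k v + 1 = 2 * k u := by exact_mod_cast h2
      omega
    · exact huv (hinj (neg_injective hEq)).symm
  · rcases lt_or_gt_of_ne huv with hlt | hgt
    · exact hadj u v hlt
    · rw [G.adj_comm, Set.inter_comm]
      exact hadj v u hgt
  · simp [hk.lt_iff_lt]
end

section
/- Let G be a finite simple graph with vertices x_1, …, x_n and suppose a grounded {L,J}-representation of G is given, inducing the order x_1 < ⋯ < x_n. Then there exist a cycle extension H of (G,<) and a grounded {L,J}-representation of H whose restriction to the vertices x_1, …, x_n coincides with the given representation of G. -/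
/-- The grounded J-shape with anchor `(a, 0)`, depth `h` and width `w`. -/
def JShape (a h w : ℝ) : Set (ℝ × ℝ) :=
  segment ℝ ((a, 0) : ℝ × ℝ) ((a, -h) : ℝ × ℝ) ∪
    segment ℝ ((a - w, -h) : ℝ × ℝ) ((a, -h) : ℝ × ℝ)

/-- The shape of a vertex in a grounded {L,J}-representation:
an L-shape if `isL = true`, a J-shape otherwise. -/
def LJShape (isL : Bool) (a h w : ℝ) : Set (ℝ × ℝ) :=
  if isL then LShape a h w else JShape a h w

/-- The horizontal endpoint of an L-shape or a J-shape. -/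
def LJEnd (isL : Bool) (a h w : ℝ) : ℝ × ℝ :=
  if isL then (a + w, -h) else (a - w, -h)

/-- A grounded {L,J}-representation of a simple graph `G`. -/
structure GroundedLJRep {V : Type} (G : SimpleGraph V) where
  a : V → ℝ
  ht : V → ℝ
  wd : V → ℝ
  isL : V → Bool
  ht_pos : ∀ v, 0 < ht v
  wd_pos : ∀ v, 0 < wd v
  a_inj : Function.Injective a
  ht_inj : Function.Injective ht
  endpoint_off : ∀ u v, u ≠ v →
    LJEnd (isL v) (a v) (ht v) (wd v) ∉ LJShape (isL u) (a u) (ht u) (wd u)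
  adj_iff : ∀ u v, u ≠ v →
    (G.Adj u v ↔
      (LJShape (isL u) (a u) (ht u) (wd u) ∩ LJShape (isL v) (a v) (ht v) (wd v)).Nonempty)

/-- `H` is a cycle extension of the graph `G` on `Fin n` taken with its natural
vertex order: the `Sum.inl` vertices induce `G`, the `Sum.inr` vertices induce
exactly the cycle `y_0 y_1 ⋯ y_{5n-1} y_0`, and (in 0-indexed notation) each
`x_i` is adjacent either exactly to `y_{5i+4}`, or exactly to `y_{5i+3}` and
`y_{5i+4}`, among the cycle vertices. -/
def IsCycleExtension (n : ℕ) (G : SimpleGraph (Fin n))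
    (H : SimpleGraph (Fin n ⊕ Fin (5 * n))) : Prop :=
  (∀ i j : Fin n, H.Adj (Sum.inl i) (Sum.inl j) ↔ G.Adj i j) ∧
  (∀ i j : Fin (5 * n), H.Adj (Sum.inr i) (Sum.inr j) ↔
    ((i.val + 1) % (5 * n) = j.val ∨ (j.val + 1) % (5 * n) = i.val)) ∧
  (∀ i : Fin n,
    (∀ j : Fin (5 * n), H.Adj (Sum.inl i) (Sum.inr j) ↔ j.val = 5 * i.val + 4) ∨
    (∀ j : Fin (5 * n), H.Adj (Sum.inl i) (Sum.inr j) ↔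
      (j.val = 5 * i.val + 3 ∨ j.val = 5 * i.val + 4)))

/-- The set of abscissas covered by the horizontal segment of a shape. -/
def LJBar (isL : Bool) (a w : ℝ) : Set ℝ :=
  if isL then Set.Icc a (a + w) else Set.Icc (a - w) a

theorem segment_prod_snd (x : ℝ) {s t : ℝ} (h : s ≤ t) :
    segment ℝ ((x, t) : ℝ × ℝ) (x, s) = {x} ×ˢ Set.Icc s t := by
  rw [segment_symm, ← Prod.image_mk_segment_right, segment_eq_Icc h, Set.singleton_prod]

theorem segment_prod_fst (y : ℝ) {s t : ℝ} (h : s ≤ t) :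
    segment ℝ ((s, y) : ℝ × ℝ) (t, y) = Set.Icc s t ×ˢ {y} := by
  rw [← Prod.image_mk_segment_left, segment_eq_Icc h, Set.prod_singleton]

theorem mem_LJShape_iff {b : Bool} {a h w : ℝ} (hh : 0 < h) (hw : 0 < w) (x y : ℝ) :
    (x, y) ∈ LJShape b a h w ↔
      (x = a ∧ -h ≤ y ∧ y ≤ 0) ∨ (x ∈ LJBar b a w ∧ y = -h) := by
  have hv := segment_prod_snd a (show -h ≤ 0 by linarith)
  cases b
  · simp only [LJShape, JShape, LJBar, Bool.false_eq_true, if_false, hv,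
      segment_prod_fst (-h) (show a - w ≤ a by linarith)]
    simp
  · simp only [LJShape, LShape, LJBar, if_true, hv,
      segment_prod_fst (-h) (show a ≤ a + w by linarith)]
    simp

/-- Two shapes with distinct anchors and distinct depths meet iff the horizontal segment of the
shallower one reaches the vertical line of the deeper one. -/
theorem LJShape_inter_nonempty_iff {b b' : Bool} {a h w a' h' w' : ℝ} (hh : 0 < h) (hw : 0 < w)
    (hh' : 0 < h') (hw' : 0 < w') (ha : a ≠ a') (hne : h ≠ h') :
    (LJShape b a h w ∩ LJShape b' a' h' w').Nonempty ↔
      (h < h' ∧ a' ∈ LJBar b a w) ∨ (h' < h ∧ a ∈ LJBar b' a' w') := by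
  constructor
  · rintro ⟨⟨x, y⟩, h1, h2⟩
    rw [mem_LJShape_iff hh hw] at h1
    rw [mem_LJShape_iff hh' hw'] at h2
    rcases h1 with ⟨rfl, h3, h4⟩ | ⟨h3, rfl⟩ <;> rcases h2 with ⟨rfl, h5, h6⟩ | ⟨h5, h6⟩
    · exact absurd rfl ha
    · exact Or.inr ⟨lt_of_le_of_ne (by linarith) hne.symm, h5⟩
    · exact Or.inl ⟨lt_of_le_of_ne (by linarith) hne, h3⟩
    · exact absurd (neg_injective h6) hne
  · rintro (⟨h1, h2⟩ | ⟨h1, h2⟩)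
    · refine ⟨(a', -h), ?_, ?_⟩
      · rw [mem_LJShape_iff hh hw]; exact Or.inr ⟨h2, rfl⟩
      · rw [mem_LJShape_iff hh' hw']; exact Or.inl ⟨rfl, by linarith, by linarith⟩
    · refine ⟨(a, -h'), ?_, ?_⟩
      · rw [mem_LJShape_iff hh hw]; exact Or.inl ⟨rfl, by linarith, by linarith⟩
      · rw [mem_LJShape_iff hh' hw']; exact Or.inr ⟨h2, rfl⟩

theorem LJEnd_notMem_LJShape {b b' : Bool} {a h w a' h' w' : ℝ} (hh : 0 < h) (hw : 0 < w)
    (hne : h ≠ h') (hend : h' < h → (LJEnd b' a' h' w').1 ≠ a) :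
    LJEnd b' a' h' w' ∉ LJShape b a h w := by
  have h2 : LJEnd b' a' h' w' = ((LJEnd b' a' h' w').1, -h') := by
    cases b' <;> simp [LJEnd]
  rw [h2, mem_LJShape_iff hh hw]
  rintro (⟨h3, h4, -⟩ | ⟨-, h3⟩)
  · exact hend (lt_of_le_of_ne (by linarith) hne.symm) h3
  · exact hne (neg_injective h3).symm

/-- A strictly increasing real sequence is refined by one with eleven new points in each gap. -/
theorem StrictMono.exists_refine_twelve {A : ℕ → ℝ} (hA : StrictMono A) :
    ∃ p : ℕ → ℝ, StrictMono p ∧ ∀ m, p (12 * m) = A m := by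
  refine ⟨fun m ↦ A (m / 12) + (A (m / 12 + 1) - A (m / 12)) * ((m % 12 : ℕ) : ℝ) / 12,
    strictMono_nat_of_lt_succ fun m ↦ ?_, fun m ↦ by simp⟩
  have hlt := hA (Nat.lt_succ_self (m / 12))
  by_cases h : m % 12 = 11
  · have h1 : (m + 1) / 12 = m / 12 + 1 := by omega
    have h2 : (m + 1) % 12 = 0 := by omega
    simp only [h1, h2, h]
    push_cast
    simp only [Nat.succ_eq_add_one] at hlt
    linarith
  · have h1 : (m + 1) / 12 = m / 12 := by omega
    have h2 : (m + 1) % 12 = m % 12 + 1 := by omega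
    simp only [h1, h2]
    push_cast
    simp only [Nat.succ_eq_add_one] at hlt
    linarith

theorem exists_position_scale {n : ℕ} {a w : Fin n → ℝ} (hw : ∀ i, 0 < w i) (ha : StrictMono a) :
    ∃ p : ℕ → ℝ, StrictMono p ∧ (∀ i : Fin n, p (12 * (i + 2)) = a i) ∧
      (∀ i, p 12 < a i - w i) ∧ ∀ i, a i + w i < p (12 * (n + 2)) := by
  obtain ⟨M, hM⟩ := (Set.finite_range fun i ↦ a i - w i).bddBelow
  obtain ⟨B, hB⟩ := (Set.finite_range fun i ↦ a i + w i).bddAbove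
  replace hM : ∀ i, M ≤ a i - w i := fun i ↦ hM ⟨i, rfl⟩
  replace hB : ∀ i, a i + w i ≤ B := fun i ↦ hB ⟨i, rfl⟩
  let A : ℕ → ℝ := fun j ↦
    if j < 2 then min M B - 3 + j else if h : j - 2 < n then a ⟨j - 2, h⟩ else B + j
  have hA : StrictMono A := by
    refine strictMono_nat_of_lt_succ fun j ↦ ?_
    have h1 := min_le_left M B
    have h2 := min_le_right M B
    have h3 : (0 : ℝ) ≤ j := j.cast_nonneg
    simp only [A]
    split_ifs with h4 h5 h6 h5 h6 h7 h7
    · push_cast; linarith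
    · have : (j : ℝ) < 2 := by exact_mod_cast h4
      linarith [hM ⟨j + 1 - 2, h6⟩, hw ⟨j + 1 - 2, h6⟩]
    · have : (j : ℝ) < 2 := by exact_mod_cast h4
      push_cast; linarith
    all_goals try omega
    · exact ha (Fin.mk_lt_mk.2 (by omega))
    · push_cast
      linarith [hB ⟨j - 2, h5⟩, hw ⟨j - 2, h5⟩]
    · push_cast; linarith
  obtain ⟨p, hp, hpA⟩ := hA.exists_refine_twelve
  refine ⟨p, hp, fun i ↦ ?_, fun i ↦ ?_, fun i ↦ ?_⟩
  · rw [hpA]; simp [A]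
  · rw [show (12 : ℕ) = 12 * 1 from rfl, hpA]
    simp only [A]
    norm_num
    linarith [hM i, min_le_left M B]
  · rw [hpA]
    simp only [A, show ¬ n + 2 < 2 by omega, show ¬ n + 2 - 2 < n by omega, if_false, dif_neg,
      not_false_eq_true]
    push_cast
    linarith [hB i, (n.cast_nonneg : (0 : ℝ) ≤ n)]

theorem exists_depth_scale {n : ℕ} {h : Fin n → ℝ} (hh : ∀ i, 0 < h i) (N : ℕ) :
    ∃ r : ℕ → ℝ, StrictMono r ∧ (∀ m, 0 < r m) ∧ (∀ m i, m < N → r m < h i) ∧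
      ∀ m i, N ≤ m → h i < r m := by
  obtain ⟨D, hD⟩ := (Set.finite_range h).bddAbove
  replace hD : ∀ i, h i ≤ D := fun i ↦ hD ⟨i, rfl⟩
  obtain ⟨ε, hε, hεh⟩ : ∃ ε > 0, ∀ i, ε ≤ h i := by
    obtain _ | _ := isEmpty_or_nonempty (Fin n)
    · exact ⟨1, one_pos, fun i ↦ isEmptyElim i⟩
    · obtain ⟨i, hi⟩ := Finite.exists_min h
      exact ⟨h i, hh i, hi⟩
  have hlt : ∀ m : ℕ, ε * (1 - 1 / ((m : ℝ) + 2)) < ε := fun m ↦ by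
    have : 0 < 1 / ((m : ℝ) + 2) := by positivity
    nlinarith
  refine ⟨fun m ↦ if m < N then ε * (1 - 1 / ((m : ℝ) + 2)) else max D ε + m + 1,
    strictMono_nat_of_lt_succ fun m ↦ ?_, fun m ↦ ?_, fun m i hm ↦ ?_, fun m i hm ↦ ?_⟩
  · have h0 : (0 : ℝ) ≤ m := m.cast_nonneg
    split_ifs with h1 h2 h2
    · have : 1 / (((m + 1 : ℕ) : ℝ) + 2) < 1 / ((m : ℝ) + 2) :=
        one_div_lt_one_div_of_lt (by positivity) (by push_cast; linarith)
      nlinarith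
    · push_cast
      linarith [hlt m, le_max_right D ε]
    · omega
    · push_cast; linarith
  · beta_reduce
    split_ifs
    · have : 1 / ((m : ℝ) + 2) < 1 := by
        rw [div_lt_one (by positivity)]
        linarith [(m.cast_nonneg : (0 : ℝ) ≤ m)]
      exact mul_pos hε (by linarith)
    · linarith [le_max_right D ε, (m.cast_nonneg : (0 : ℝ) ≤ m)]
  · simp only [hm, if_true]
    exact (hlt m).trans_le (hεh i)
  · simp only [not_lt.2 hm, if_false]
    linarith [hD i, le_max_left D ε, (m.cast_nonneg : (0 : ℝ) ≤ m)]

/-- The position of the anchor of the `k`-th cycle vertex, in a scale in which the `i`-th vertex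
of the given graph has position `12 * (i + 2)`. -/
def cycleAnchor (n k : ℕ) : ℕ :=
  if k = 0 then 12 * n + 26 else if k = 1 then 1 else if k = 2 then 0
  else 12 * (k / 5 + 1) + 2 * (k % 5) + 2

/-- The position of the horizontal endpoint of the `k`-th cycle vertex. -/
def cycleEnd (n k : ℕ) : ℕ :=
  if k = 0 then 12 * n + 30 else if k = 1 then 12 * n + 29
  else if k + 1 = 5 * n then 12 * n + 27 else cycleAnchor n (k + 1) + 1

/-- The rank of the depth of the `k`-th cycle vertex; ranks below `5 * n` are shallower than every
vertex of the given graph, the others are deeper. -/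
def cycleRank (n k : ℕ) : ℕ :=
  if k = 0 then 5 * n + 1 else if k = 1 then 5 * n else k

theorem cycleAnchor_lt_cycleEnd {n k : ℕ} (hk : k < 5 * n) :
    cycleAnchor n k < cycleEnd n k := by
  unfold cycleEnd cycleAnchor
  split_ifs <;> omega

theorem cycleAnchor_injOn {n k l : ℕ} (hk : k < 5 * n) (hl : l < 5 * n)
    (h : cycleAnchor n k = cycleAnchor n l) : k = l := by
  unfold cycleAnchor at h
  split_ifs at h <;> omega

theorem cycleAnchor_ne {n k : ℕ} (i : ℕ) : cycleAnchor n k ≠ 12 * (i + 2) := by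
  unfold cycleAnchor
  split_ifs <;> omega

theorem cycleRank_injOn {n k l : ℕ} (hk : k < 5 * n) (hl : l < 5 * n)
    (h : cycleRank n k = cycleRank n l) : k = l := by
  unfold cycleRank at h
  split_ifs at h <;> omega

theorem cycleEnd_ne_cycleAnchor {n k l : ℕ} (hk : k < 5 * n) (hl : l < 5 * n)
    (h : cycleRank n k < cycleRank n l) : cycleEnd n k ≠ cycleAnchor n l := by
  unfold cycleRank at h
  unfold cycleEnd cycleAnchor
  split_ifs at h ⊢ <;> omega

theorem cycleEnd_ne {n k : ℕ} (i : ℕ) (h : cycleRank n k < 5 * n) :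
    cycleEnd n k ≠ 12 * (i + 2) := by
  unfold cycleRank at h
  unfold cycleEnd cycleAnchor
  split_ifs at h ⊢ <;> omega

theorem cycle_reaches_iff {n k l : ℕ} (hk : k < 5 * n) (hl : l < 5 * n) :
    (cycleRank n k < cycleRank n l ∧
      cycleAnchor n k ≤ cycleAnchor n l ∧ cycleAnchor n l ≤ cycleEnd n k) ↔
    (k = 1 ∧ l = 0) ∨ (k = 2 ∧ l = 1) ∨ (2 ≤ k ∧ l = k + 1) ∨ (k + 1 = 5 * n ∧ l = 0) := by
  unfold cycleEnd cycleAnchor cycleRank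
  split_ifs <;> first | omega | contradiction

theorem succ_mod_eq_iff {N k l : ℕ} (hk : k < N) :
    (k + 1) % N = l ↔ (k + 1 = N ∧ l = 0) ∨ (k + 1 < N ∧ l = k + 1) := by
  rcases Nat.lt_or_ge (k + 1) N with h | h
  · rw [Nat.mod_eq_of_lt h]; omega
  · have h' : k + 1 = N := by omega
    rw [h', Nat.mod_self]; omega

theorem cycle_meets_vertex_iff {n k i : ℕ} (hi : i < n) :
    (cycleRank n k < 5 * n ∧
      cycleAnchor n k ≤ 12 * (i + 2) ∧ 12 * (i + 2) ≤ cycleEnd n k) ↔ k = 5 * i + 4 := by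
  unfold cycleEnd cycleAnchor cycleRank
  split_ifs <;> first | omega | contradiction

theorem cycleAnchor_outside {n k : ℕ} (h : 5 * n ≤ cycleRank n k) (hk : k < 5 * n) :
    cycleAnchor n k ≤ 12 ∨ 12 * (n + 2) ≤ cycleAnchor n k := by
  unfold cycleRank at h
  unfold cycleAnchor
  split_ifs at h ⊢ <;> omega

/-- The graph whose edges are the pairs of distinct vertices with intersecting shapes. -/
def LJGraph {V : Type} (isL : V → Bool) (a h w : V → ℝ) : SimpleGraph V where
  Adj u v := u ≠ v ∧
    (LJShape (isL u) (a u) (h u) (w u) ∩ LJShape (isL v) (a v) (h v) (w v)).Nonempty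
  symm := ⟨fun _ _ h ↦ ⟨h.1.symm, by rw [Set.inter_comm]; exact h.2⟩⟩
  loopless := ⟨fun _ h ↦ h.1 rfl⟩

/-- Every grounded {L,J}-representation of a graph `G` on `Fin n`
inducing the natural order can be extended (keeping the shapes of the original
vertices) to a grounded {L,J}-representation of some cycle extension `H` of `G`. -/
theorem extend_groundedLJ_to_cycle_extension (n : ℕ) (G : SimpleGraph (Fin n))
    (R : GroundedLJRep G) (hord : ∀ i j : Fin n, i < j ↔ R.a i < R.a j) :
    ∃ H : SimpleGraph (Fin n ⊕ Fin (5 * n)), IsCycleExtension n G H ∧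
      ∃ R' : GroundedLJRep H, ∀ i : Fin n,
        R'.a (Sum.inl i) = R.a i ∧ R'.ht (Sum.inl i) = R.ht i ∧
        R'.wd (Sum.inl i) = R.wd i ∧ R'.isL (Sum.inl i) = R.isL i := by
  have ha : StrictMono R.a := fun i j h ↦ (hord i j).1 h
  obtain ⟨p, hp, hpa, hpl, hpr⟩ := exists_position_scale R.wd_pos ha
  obtain ⟨r, hr, hr0, hrlt, hrgt⟩ := exists_depth_scale R.ht_pos (5 * n)
  let ya : Fin (5 * n) → ℝ := fun k ↦ p (cycleAnchor n k)
  let yh : Fin (5 * n) → ℝ := fun k ↦ r (cycleRank n k)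
  let yw : Fin (5 * n) → ℝ := fun k ↦ p (cycleEnd n k) - p (cycleAnchor n k)
  let a : Fin n ⊕ Fin (5 * n) → ℝ := Sum.elim R.a ya
  let h : Fin n ⊕ Fin (5 * n) → ℝ := Sum.elim R.ht yh
  let w : Fin n ⊕ Fin (5 * n) → ℝ := Sum.elim R.wd yw
  let b : Fin n ⊕ Fin (5 * n) → Bool := Sum.elim R.isL fun _ ↦ true
  have hyw : ∀ k, 0 < yw k := fun k ↦ sub_pos.2 (hp (cycleAnchor_lt_cycleEnd k.2))
  have hh0 : ∀ v, 0 < h v := by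
    rintro (i | k)
    exacts [R.ht_pos i, hr0 _]
  have hw0 : ∀ v, 0 < w v := by
    rintro (i | k)
    exacts [R.wd_pos i, hyw k]
  have hya : ∀ k, ya k + yw k = p (cycleEnd n k) := fun k ↦ by simp [ya, yw]
  have hane : ∀ i k, R.a i ≠ ya k := fun i k hik ↦
    cycleAnchor_ne i (hp.injective ((hpa i).trans hik)).symm
  have hyh_lt : ∀ i k, yh k < R.ht i ↔ cycleRank n k < 5 * n := fun i k ↦
    ⟨fun hlt ↦ lt_of_not_ge fun hge ↦ (hrgt _ i hge).not_gt hlt, hrlt _ i⟩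
  have hyh_gt : ∀ i k, R.ht i < yh k ↔ 5 * n ≤ cycleRank n k := fun i k ↦
    ⟨fun hlt ↦ le_of_not_gt fun hge ↦ (hrlt _ i hge).not_gt hlt, hrgt _ i⟩
  have hhne : ∀ i k, R.ht i ≠ yh k := fun i k ↦ by
    rcases Nat.lt_or_ge (cycleRank n k) (5 * n) with hlt | hge
    exacts [((hyh_lt i k).2 hlt).ne', ((hyh_gt i k).2 hge).ne]
  have ha_inj : Function.Injective a := by
    rintro (i | k) (j | l) hij
    · exact congrArg _ (R.a_inj hij)
    · exact absurd hij (hane i l)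
    · exact absurd hij.symm (hane j k)
    · exact congrArg _ (Fin.ext (cycleAnchor_injOn k.2 l.2 (hp.injective hij)))
  have hh_inj : Function.Injective h := by
    rintro (i | k) (j | l) hij
    · exact congrArg _ (R.ht_inj hij)
    · exact absurd hij (hhne i l)
    · exact absurd hij.symm (hhne j k)
    · exact congrArg _ (Fin.ext (cycleRank_injOn k.2 l.2 (hr.injective hij)))
  have houtside : ∀ i k, R.ht i < yh k → ya k < R.a i - R.wd i ∨ R.a i + R.wd i < ya k := by
    intro i k hik
    rcases cycleAnchor_outside ((hyh_gt i k).1 hik) k.2 with hl | hl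
    · exact Or.inl ((hp.monotone hl).trans_lt (hpl i))
    · exact Or.inr ((hpr i).trans_le (hp.monotone hl))
  have hend : ∀ u v, u ≠ v → h v < h u → (LJEnd (b v) (a v) (h v) (w v)).1 ≠ a u := by
    rintro (i | k) (j | l) hne hlt
    · intro he
      refine R.endpoint_off i j (fun hij ↦ hne (congrArg _ hij)) ?_
      have h2 : LJEnd (R.isL j) (R.a j) (R.ht j) (R.wd j) = (R.a i, -R.ht j) := by
        refine Prod.ext he ?_
        cases R.isL j <;> simp [LJEnd]
      rw [h2, mem_LJShape_iff (R.ht_pos i) (R.wd_pos i)]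
      have hlt' : R.ht j < R.ht i := hlt
      exact Or.inl ⟨rfl, by linarith, by linarith [R.ht_pos j]⟩
    · change ya l + yw l ≠ R.a i
      rw [hya, ← hpa]
      exact hp.injective.ne (cycleEnd_ne _ ((hyh_lt i l).1 hlt))
    · have ho := houtside j k hlt
      have hwj := R.wd_pos j
      change (LJEnd (R.isL j) (R.a j) (R.ht j) (R.wd j)).1 ≠ ya k
      intro he
      cases hb : R.isL j <;> simp only [hb, LJEnd, if_true, if_false, Bool.false_eq_true] at he <;>
        rcases ho with ho | ho <;> linarith
    · change ya l + yw l ≠ ya k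
      rw [hya]
      exact hp.injective.ne (cycleEnd_ne_cycleAnchor l.2 k.2 (hr.lt_iff_lt.1 hlt))
  have hadj : ∀ u v, (LJGraph b a h w).Adj u v ↔ u ≠ v ∧
      ((h u < h v ∧ a v ∈ LJBar (b u) (a u) (w u)) ∨
        (h v < h u ∧ a u ∈ LJBar (b v) (a v) (w v))) := fun u v ↦
    and_congr_right fun huv ↦ LJShape_inter_nonempty_iff (hh0 u) (hw0 u) (hh0 v) (hw0 v)
      (ha_inj.ne huv) (hh_inj.ne huv)
  refine ⟨LJGraph b a h w, ⟨fun i j ↦ ?_, fun k l ↦ ?_, fun i ↦ Or.inl fun k ↦ ?_⟩,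
    ⟨a, h, w, b, hh0, hw0, ha_inj, hh_inj,
      fun u v huv ↦ LJEnd_notMem_LJShape (hh0 u) (hw0 u) (hh_inj.ne huv) (hend u v huv),
      fun u v huv ↦ and_iff_right huv⟩, fun i ↦ ⟨rfl, rfl, rfl, rfl⟩⟩
  · by_cases hij : i = j
    · subst hij; simp
    · rw [R.adj_iff i j hij]
      exact and_iff_right fun h ↦ hij (Sum.inl_injective h)
  · have key : ∀ k l : Fin (5 * n), (yh k < yh l ∧ ya l ∈ Set.Icc (ya k) (ya k + yw k)) ↔
        ((k : ℕ) = 1 ∧ (l : ℕ) = 0) ∨ ((k : ℕ) = 2 ∧ (l : ℕ) = 1) ∨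
          (2 ≤ (k : ℕ) ∧ (l : ℕ) = k + 1) ∨ ((k : ℕ) + 1 = 5 * n ∧ (l : ℕ) = 0) := fun k l ↦ by
      rw [hya, Set.mem_Icc, ← cycle_reaches_iff k.2 l.2]
      exact and_congr hr.lt_iff_lt (and_congr hp.le_iff_le hp.le_iff_le)
    have hkl := (hadj (Sum.inr k) (Sum.inr l)).trans
      (and_congr_right' (or_congr (key k l) (key l k)))
    rw [hkl, succ_mod_eq_iff k.2, succ_mod_eq_iff l.2, Ne, Sum.inr.injEq, Fin.ext_iff]
    have := k.2
    have := l.2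
    omega
  · have hno : ¬ (R.ht i < yh k ∧ ya k ∈ LJBar (R.isL i) (R.a i) (R.wd i)) := by
      rintro ⟨hlt, hmem⟩
      have hwi := R.wd_pos i
      have ho := houtside i k hlt
      cases hb : R.isL i <;>
        simp only [hb, LJBar, if_true, if_false, Bool.false_eq_true] at hmem <;>
        rcases ho with ho | ho <;> linarith [hmem.1, hmem.2]
    have hyes : (yh k < R.ht i ∧ R.a i ∈ Set.Icc (ya k) (ya k + yw k)) ↔
        (k : ℕ) = 5 * i + 4 := by
      rw [hya, Set.mem_Icc, ← hpa, hyh_lt, ← cycle_meets_vertex_iff i.2]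
      exact and_congr_right' (and_congr hp.le_iff_le hp.le_iff_le)
    rw [hadj, and_iff_right Sum.inl_ne_inr]
    exact (or_congr_right hyes).trans (or_iff_right hno)
end

section
/- Let G be a finite simple graph with vertices x_1, …, x_n and suppose a grounded segment representation of G is given, inducing the order x_1 < ⋯ < x_n. Then there exist a cycle extension H of (G,<) and a grounded segment representation of H whose restriction to the vertices x_1, …, x_n coincides with the given representation of G. -/
/-- The grounded segment from `(a, 0)` to `(b, -c)`. -/
def GSeg (a b c : ℝ) : Set (ℝ × ℝ) :=
  segment ℝ ((a, 0) : ℝ × ℝ) ((b, -c) : ℝ × ℝ)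

/-- A grounded segment representation of a simple graph `G`. -/
structure GroundedSegRep {V : Type} (G : SimpleGraph V) where
  a : V → ℝ
  b : V → ℝ
  c : V → ℝ
  c_pos : ∀ v, 0 < c v
  a_inj : Function.Injective a
  inter_finite : ∀ u v, u ≠ v → (GSeg (a u) (b u) (c u) ∩ GSeg (a v) (b v) (c v)).Finite
  endpoints_off : ∀ u v, u ≠ v →
    ((a v, 0) : ℝ × ℝ) ∉ GSeg (a u) (b u) (c u) ∧
    ((b v, -c v) : ℝ × ℝ) ∉ GSeg (a u) (b u) (c u)
  adj_iff : ∀ u v, u ≠ v →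
    (G.Adj u v ↔ (GSeg (a u) (b u) (c u) ∩ GSeg (a v) (b v) (c v)).Nonempty)

theorem mem_GSeg_iff {a b c : ℝ} {p : ℝ × ℝ} :
    p ∈ GSeg a b c ↔ ∃ t : ℝ, 0 ≤ t ∧ t ≤ 1 ∧ p.1 = a + t * (b - a) ∧ p.2 = -(t * c) := by
  unfold GSeg
  rw [segment_eq_image']
  constructor
  · rintro ⟨t, ⟨h0, h1⟩, rfl⟩
    exact ⟨t, h0, h1, by simp, by simp⟩
  · rintro ⟨t, h0, h1, h2, h3⟩
    exact ⟨t, ⟨h0, h1⟩, by ext <;> simp [h2, h3]⟩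

theorem anchor_mem_GSeg (a b c : ℝ) : ((a, 0) : ℝ × ℝ) ∈ GSeg a b c :=
  left_mem_segment ℝ _ _

theorem fst_mem_Icc_of_mem_GSeg {a b c l r : ℝ} {p : ℝ × ℝ} (hp : p ∈ GSeg a b c)
    (ha : a ∈ Set.Icc l r) (hb : b ∈ Set.Icc l r) : p.1 ∈ Set.Icc l r := by
  obtain ⟨t, h0, h1, h2, -⟩ := mem_GSeg_iff.1 hp
  obtain ⟨ha1, ha2⟩ := ha
  obtain ⟨hb1, hb2⟩ := hb
  rw [h2]
  constructor <;> nlinarith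

theorem neg_le_snd_of_mem_GSeg {a b c : ℝ} {p : ℝ × ℝ} (hp : p ∈ GSeg a b c) (hc : 0 < c) :
    -c ≤ p.2 := by
  obtain ⟨t, h0, h1, -, h3⟩ := mem_GSeg_iff.1 hp
  rw [h3]
  nlinarith

theorem GSeg_inter_subsingleton {a b c a' b' c' : ℝ} (hc' : 0 < c') (h : a ≠ a') :
    (GSeg a b c ∩ GSeg a' b' c').Subsingleton := by
  rintro p ⟨hp, hp'⟩ q ⟨hq, hq'⟩
  obtain ⟨t, -, -, h1, h2⟩ := mem_GSeg_iff.1 hp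
  obtain ⟨t', -, -, h1', h2'⟩ := mem_GSeg_iff.1 hp'
  obtain ⟨s, -, -, k1, k2⟩ := mem_GSeg_iff.1 hq
  obtain ⟨s', -, -, k1', k2'⟩ := mem_GSeg_iff.1 hq'
  have e1 : t * c = t' * c' := by linarith
  have e2 : s * c = s' * c' := by linarith
  have e3 : a + t * (b - a) = a' + t' * (b' - a') := by linarith
  have e4 : a + s * (b - a) = a' + s' * (b' - a') := by linarith
  have key : (t - s) * ((a' - a) * c') = 0 := by
    have e5 : t * ((b - a) * c' - c * (b' - a')) = (a' - a) * c' := by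
      linear_combination c' * e3 - (b' - a') * e1
    have e6 : s * ((b - a) * c' - c * (b' - a')) = (a' - a) * c' := by
      linear_combination c' * e4 - (b' - a') * e2
    linear_combination s * e5 - t * e6
  have hts : t = s := by
    rcases mul_eq_zero.1 key with h0 | h0
    · linarith
    · rcases mul_eq_zero.1 h0 with h0 | h0
      · exact absurd (by linarith) h
      · exact absurd h0 hc'.ne'
  subst hts
  ext
  · rw [h1, k1]
  · rw [h2, k2]

/-- Two grounded segments with distinct anchors meet, and neither contains the lower endpoint
of the other. -/
def ProperCross (a b c a' b' c' : ℝ) : Prop :=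
  a ≠ a' ∧ (GSeg a b c ∩ GSeg a' b' c').Nonempty ∧
    ((b', -c') : ℝ × ℝ) ∉ GSeg a b c ∧ ((b, -c) : ℝ × ℝ) ∉ GSeg a' b' c'

theorem ProperCross.symm {a b c a' b' c' : ℝ} (h : ProperCross a b c a' b' c') :
    ProperCross a' b' c' a b c :=
  ⟨h.1.symm, by rw [Set.inter_comm]; exact h.2.1, h.2.2.2, h.2.2.1⟩

theorem properCross_of_lt {a b c a' b' c' : ℝ} (hc : 0 < c) (hc' : 0 < c') (ha : a < a')
    (h : (b' - a) * c < c' * (b - a)) (h' : c * (b' - a') < (b - a') * c') :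
    ProperCross a b c a' b' c' := by
  refine ⟨ha.ne, ?_, ?_, ?_⟩
  · set Q := (b - a) * c' - c * (b' - a') with hQ
    have hQ1 : (a' - a) * c' < Q := by rw [hQ]; linarith
    have hQ2 : (a' - a) * c < Q := by rw [hQ]; linarith
    have h1 : 0 < (a' - a) * c' := mul_pos (by linarith) hc'
    have h2 : 0 < (a' - a) * c := mul_pos (by linarith) hc
    have hQ0 : 0 < Q := h1.trans hQ1
    refine ⟨(a + (a' - a) * c' / Q * (b - a), -((a' - a) * c' / Q * c)),
      mem_GSeg_iff.2 ⟨(a' - a) * c' / Q, by positivity, ?_, rfl, rfl⟩,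
      mem_GSeg_iff.2 ⟨(a' - a) * c / Q, by positivity, ?_, ?_, ?_⟩⟩
    · rw [div_le_one hQ0]; exact hQ1.le
    · rw [div_le_one hQ0]; exact hQ2.le
    · field_simp
      rw [hQ]; ring
    · field_simp
  · intro hm
    obtain ⟨t, -, -, h1, h2⟩ := mem_GSeg_iff.1 hm
    dsimp only at h1 h2
    have h2' : c' = t * c := by linarith
    subst h2'
    rw [h1] at h
    linarith
  · intro hm
    obtain ⟨t, -, -, h1, h2⟩ := mem_GSeg_iff.1 hm
    dsimp only at h1 h2
    have h2' : c = t * c' := by linarith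
    subst h2'
    rw [h1] at h'
    linarith

/-- A graph is represented by grounded segments as soon as adjacent vertices have properly
crossing segments and nonadjacent vertices have disjoint segments. -/
def GroundedSegRep.ofProperCross {V : Type} {H : SimpleGraph V} (a b c : V → ℝ)
    (hc : ∀ v, 0 < c v)
    (hadj : ∀ u v, H.Adj u v → ProperCross (a u) (b u) (c u) (a v) (b v) (c v))
    (hdisj : ∀ u v, u ≠ v → ¬ H.Adj u v →
      Disjoint (GSeg (a u) (b u) (c u)) (GSeg (a v) (b v) (c v))) :
    GroundedSegRep H :=
  have hne : ∀ u v, u ≠ v → a u ≠ a v := by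
    intro u v huv h
    by_cases huv' : H.Adj u v
    · exact (hadj u v huv').1 h
    · exact Set.disjoint_left.1 (hdisj u v huv huv') (anchor_mem_GSeg _ _ _)
        (h ▸ anchor_mem_GSeg _ _ _)
  { a := a
    b := b
    c := c
    c_pos := hc
    a_inj := fun u v h => by_contra fun huv => hne u v huv h
    inter_finite := fun u v huv =>
      (GSeg_inter_subsingleton (hc v) (hne u v huv)).finite
    endpoints_off := by
      intro u v huv
      constructor
      · intro hm
        obtain ⟨t, -, -, h1, h2⟩ := mem_GSeg_iff.1 hm
        have ht : t = 0 := by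
          have : t * c u = 0 := by simpa using h2
          exact (mul_eq_zero.1 this).resolve_right (hc u).ne'
        subst ht
        exact hne u v huv (by simpa using h1.symm)
      · by_cases huv' : H.Adj u v
        · exact (hadj u v huv').2.2.1
        · exact Set.disjoint_right.1 (hdisj u v huv huv') (right_mem_segment ℝ _ _)
    adj_iff := by
      intro u v huv
      refine ⟨fun h => (hadj u v h).2.1, fun h => ?_⟩
      by_contra huv'
      exact Set.not_disjoint_iff_nonempty_inter.2 h (hdisj u v huv huv') }

/-- Parameters placing a cycle of `5 * n` grounded segments around `n` given grounded segments.
All cycle segments but the first two stay above depth `4 * η`, where the `i`-th given segment is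
within `δ` of its anchor `A i`; the points `E i` separate consecutive anchors. -/
structure CycleLayout (n : ℕ) (a b c : Fin n → ℝ) where
  A : ℕ → ℝ
  E : ℕ → ℝ
  δ : ℝ
  η : ℝ
  X : ℝ
  C : ℝ
  D : ℝ
  δ_pos : 0 < δ
  η_pos : 0 < η
  D_pos : 0 < D
  A_eq : ∀ i : Fin n, A i = a i
  E_lt_A : ∀ i < n, E i + 8 * δ < A i
  A_lt_E : ∀ i < n, A i + 4 * δ < E (i + 1)
  depth_lt : ∀ i, 4 * η < c i
  drift_le : ∀ i, 4 * η * |b i - a i| ≤ δ * c i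
  left_lt : ∀ i, E 0 + 2 * δ < a i ∧ E 0 + 2 * δ < b i
  le_right : ∀ i, a i ≤ X ∧ b i ≤ X
  right_lt : X < E n - 3 * δ
  le_C : ∀ i, c i ≤ C
  lt_D : C * (E n - E 0 - δ) < D * (E n - 3 * δ - X)

namespace CycleLayout

variable {n : ℕ} {a b c : Fin n → ℝ} (L : CycleLayout n a b c)

/-- Left end of the horizontal extent of the `j`-th cycle segment, for `j ≠ 0`. -/
noncomputable def lo (j : ℕ) : ℝ :=
  if j % 5 = 0 then L.E (j / 5) - 3 * L.δ
  else if j % 5 = 1 then L.E (j / 5) - L.δ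
  else if j % 5 = 2 then L.E (j / 5) + L.δ
  else if j % 5 = 3 then L.A (j / 5) - 6 * L.δ
  else L.A (j / 5) - 4 * L.δ

/-- Right end of the horizontal extent of the `j`-th cycle segment, for `j ≠ 0`. -/
noncomputable def hi (j : ℕ) : ℝ :=
  if j % 5 = 0 then L.E (j / 5)
  else if j % 5 = 1 then L.E (j / 5) + 2 * L.δ
  else if j % 5 = 2 then L.A (j / 5) - 5 * L.δ
  else if j % 5 = 3 then L.A (j / 5) - 3 * L.δ
  else L.E (j / 5 + 1) - 2 * L.δ

/-- Abscissa of the anchor of the `j`-th cycle segment. -/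
noncomputable def anchor (j : ℕ) : ℝ :=
  if j = 0 then L.E n - 3 * L.δ else if j % 5 % 2 = 0 then L.lo j else L.hi j

/-- Abscissa of the lower endpoint of the `j`-th cycle segment. -/
noncomputable def tip (j : ℕ) : ℝ :=
  if j = 0 then L.E 0 - 2 * L.δ else if j % 5 % 2 = 0 then L.hi j else L.lo j

/-- Depth of the lower endpoint of the `j`-th cycle segment. -/
noncomputable def depth (j : ℕ) : ℝ :=
  if j ≤ 1 then L.D else if j % 5 = 4 then L.η else 4 * L.η

/-- The `j`-th cycle segment. -/
noncomputable def seg (j : ℕ) : Set (ℝ × ℝ) := GSeg (L.anchor j) (L.tip j) (L.depth j)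

theorem lo_lt_hi {j : ℕ} (hj : j < 5 * n) : L.lo j < L.hi j := by
  have h1 := L.E_lt_A (j / 5) (by omega)
  have h2 := L.A_lt_E (j / 5) (by omega)
  have h3 := L.δ_pos
  unfold lo hi
  split_ifs <;> linarith

theorem lo_succ_eq (j : ℕ) : L.lo (j + 1) =
    if j % 5 = 0 then L.E (j / 5) - L.δ
    else if j % 5 = 1 then L.E (j / 5) + L.δ
    else if j % 5 = 2 then L.A (j / 5) - 6 * L.δ
    else if j % 5 = 3 then L.A (j / 5) - 4 * L.δ
    else L.E (j / 5 + 1) - 3 * L.δ := by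
  obtain ⟨i, k, hk, rfl⟩ : ∃ i k, k < 5 ∧ j = 5 * i + k :=
    ⟨j / 5, j % 5, Nat.mod_lt _ (by norm_num), by omega⟩
  have e : ∀ m < 5, (5 * i + m) % 5 = m ∧ (5 * i + m) / 5 = i := by omega
  interval_cases k
  all_goals first
    | (rw [show 5 * i + 4 + 1 = 5 * (i + 1) from by ring]; simp [lo, e])
    | simp [lo, e, add_assoc]

theorem lo_lt_lo_succ {j : ℕ} (hj : j < 5 * n) : L.lo j < L.lo (j + 1) := by
  have h1 := L.E_lt_A (j / 5) (by omega)
  have h2 := L.A_lt_E (j / 5) (by omega)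
  have h3 := L.δ_pos
  rw [lo_succ_eq]
  unfold lo
  split_ifs <;> linarith

theorem lo_succ_lt_hi {j : ℕ} (hj : j < 5 * n) : L.lo (j + 1) < L.hi j := by
  have h1 := L.E_lt_A (j / 5) (by omega)
  have h2 := L.A_lt_E (j / 5) (by omega)
  have h3 := L.δ_pos
  rw [lo_succ_eq]
  unfold hi
  split_ifs <;> linarith

theorem hi_lt_lo_add_two {j : ℕ} (hj : j < 5 * n) : L.hi j < L.lo (j + 2) := by
  have h1 := L.E_lt_A (j / 5) (by omega)
  have h2 := L.A_lt_E (j / 5) (by omega)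
  have h3 := L.δ_pos
  obtain ⟨i, k, hk, rfl⟩ : ∃ i k, k < 5 ∧ j = 5 * i + k :=
    ⟨j / 5, j % 5, Nat.mod_lt _ (by norm_num), by omega⟩
  have e : ∀ m < 5, (5 * i + m) % 5 = m ∧ (5 * i + m) / 5 = i := by omega
  have e' : ∀ m < 5, (5 * (i + 1) + m) % 5 = m ∧ (5 * (i + 1) + m) / 5 = i + 1 := by omega
  interval_cases k
  · simp [lo, hi, e] at *; linarith
  · simp [lo, hi, e, add_assoc] at *; linarith
  · simp [lo, hi, e, add_assoc] at *; linarith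
  · rw [show 5 * i + 3 + 2 = 5 * (i + 1) from by ring]
    simp [lo, hi, e] at *; linarith
  · rw [show 5 * i + 4 + 2 = 5 * (i + 1) + 1 from by ring]
    simp [lo, hi, e, e'] at *; linarith

theorem lo_mono {j k : ℕ} (hjk : j ≤ k) (hk : k < 5 * n) : L.lo j ≤ L.lo k := by
  induction k, hjk using Nat.le_induction with
  | base => exact le_rfl
  | succ k _ ih => exact (ih (by omega)).trans (L.lo_lt_lo_succ (by omega)).le

theorem hi_mono {j k : ℕ} (hjk : j ≤ k) (hk : k < 5 * n) : L.hi j ≤ L.hi k := by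
  induction k, hjk using Nat.le_induction with
  | base => exact le_rfl
  | succ k _ ih =>
    exact (ih (by omega)).trans
      ((L.hi_lt_lo_add_two (by omega)).trans (L.lo_succ_lt_hi hk)).le

theorem hi_lt_lo {j k : ℕ} (hjk : j + 2 ≤ k) (hk : k < 5 * n) : L.hi j < L.lo k :=
  (L.hi_lt_lo_add_two (by omega)).trans_le (L.lo_mono hjk hk)

theorem depth_pos (j : ℕ) : 0 < L.depth j := by
  have := L.D_pos
  have := L.η_pos
  unfold depth
  split_ifs <;> linarith

theorem depth_le {j : ℕ} (hj : 2 ≤ j) : L.depth j ≤ 4 * L.η := by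
  have := L.η_pos
  unfold depth
  split_ifs
  · omega
  all_goals linarith

theorem fst_mem_Icc {j : ℕ} (h0 : j ≠ 0) (hj : j < 5 * n) {p : ℝ × ℝ} (hp : p ∈ L.seg j) :
    p.1 ∈ Set.Icc (L.lo j) (L.hi j) := by
  have h := (L.lo_lt_hi hj).le
  refine fst_mem_Icc_of_mem_GSeg hp ?_ ?_ <;> simp only [anchor, tip, if_neg h0] <;> split_ifs <;>
    simp [h]

theorem disjoint_seg {j k : ℕ} (h0 : j ≠ 0) (hjk : j + 2 ≤ k) (hk : k < 5 * n) :
    Disjoint (L.seg j) (L.seg k) := by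
  rw [Set.disjoint_left]
  intro p hp hp'
  have h1 := L.fst_mem_Icc h0 (by omega) hp
  have h2 := L.fst_mem_Icc (by omega) hk hp'
  linarith [h1.2, h2.1, L.hi_lt_lo hjk hk]

theorem E_zero_lt (hn : 0 < n) : L.E 0 - 2 * L.δ < L.E n - 3 * L.δ := by
  have := L.left_lt ⟨0, hn⟩
  have := L.le_right ⟨0, hn⟩
  linarith [L.right_lt, L.δ_pos]

theorem C_lt_neg_snd (hn : 0 < n) {p : ℝ × ℝ} (hp : p ∈ L.seg 0) (hX : p.1 ≤ L.X) :
    L.C < -p.2 := by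
  obtain ⟨t, h0, h1, h2, h3⟩ := mem_GSeg_iff.1 hp
  simp only [anchor, tip, depth, if_true, Nat.zero_le] at h2 h3
  have hD := L.D_pos
  have hW := L.E_zero_lt hn
  have h := L.lt_D
  have h4 : L.E n - 3 * L.δ - L.X ≤ t * (L.E n - L.E 0 - L.δ) := by linarith
  have h5 := mul_le_mul_of_nonneg_left h4 hD.le
  rw [h3, neg_neg]
  by_contra! hc
  have := mul_le_mul_of_nonneg_right hc (show 0 ≤ L.E n - L.E 0 - L.δ by linarith)
  linarith

theorem disjoint_seg_zero (hn : 0 < n) {s : Set (ℝ × ℝ)} (hs : ∀ p ∈ s, p.1 ≤ L.X ∧ -p.2 ≤ L.C) :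
    Disjoint (L.seg 0) s := by
  rw [Set.disjoint_left]
  intro p hp hp'
  obtain ⟨h1, h2⟩ := hs p hp'
  linarith [L.C_lt_neg_snd hn hp h1]

theorem disjoint_seg_zero_seg {j : ℕ} (h2 : 2 ≤ j) (hj : j + 1 < 5 * n) :
    Disjoint (L.seg 0) (L.seg j) := by
  have hn : 0 < n := by omega
  refine L.disjoint_seg_zero hn fun p hp => ⟨?_, ?_⟩
  · refine (L.fst_mem_Icc (by omega) (by omega) hp).2.trans
      ((L.hi_mono (show j ≤ 5 * (n - 1) + 3 by omega) (by omega)).trans ?_)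
    have e : (5 * (n - 1) + 3) % 5 = 3 ∧ (5 * (n - 1) + 3) / 5 = n - 1 := by omega
    have h := (L.le_right ⟨n - 1, by omega⟩).1
    rw [← L.A_eq] at h
    simp only [hi, e]
    norm_num
    linarith [L.δ_pos]
  · have h := neg_le_snd_of_mem_GSeg hp (L.depth_pos j)
    linarith [L.depth_le h2, L.depth_lt ⟨0, hn⟩, L.le_C ⟨0, hn⟩]

/-- The cycle segments `j` and `k` cross properly. -/
def Crossing (j k : ℕ) : Prop :=
  ProperCross (L.anchor j) (L.tip j) (L.depth j) (L.anchor k) (L.tip k) (L.depth k)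

theorem crossing_zero_one (hn : 0 < n) : L.Crossing 0 1 := by
  have h1 := L.E_zero_lt hn
  have h2 := L.left_lt ⟨0, hn⟩
  have h3 := L.le_right ⟨0, hn⟩
  have h4 := L.right_lt
  have hδ := L.δ_pos
  have hD := L.D_pos
  refine ProperCross.symm (properCross_of_lt (L.depth_pos _) (L.depth_pos _) ?_ ?_ ?_) <;>
    simp [anchor, tip, depth, lo, hi] <;> nlinarith

theorem crossing_zero_last (hn : 0 < n) : L.Crossing 0 (5 * n - 1) := by
  obtain ⟨m, rfl⟩ : ∃ m, n = m + 1 := ⟨n - 1, by omega⟩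
  have h0 := L.left_lt ⟨m, by omega⟩
  have h1 := L.A_lt_E m (by omega)
  have hδ := L.δ_pos
  have hD := L.D_pos
  have hη := L.η_pos
  rw [← L.A_eq] at h0
  have e : 5 * (m + 1) - 1 = 5 * m + 4 := by omega
  have e1 : (5 * m + 4) % 5 = 4 ∧ (5 * m + 4) / 5 = m := by omega
  have hlow : L.E 0 - 2 * L.δ < L.A m - 4 * L.δ := by
    have := L.E_lt_A 0 hn
    have h5 := L.lo_mono (show 2 ≤ 5 * m + 4 by omega) (by omega)
    simp [lo, e1] at h5
    linarith
  rw [e]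
  refine ProperCross.symm (properCross_of_lt (L.depth_pos _) (L.depth_pos _) ?_ ?_ ?_) <;>
    simp [anchor, tip, depth, lo, hi, e1]
  · linarith
  · nlinarith
  · nlinarith

theorem crossing_succ {j : ℕ} (h0 : j ≠ 0) (hj : j + 1 < 5 * n) : L.Crossing j (j + 1) := by
  have u1 := L.lo_lt_lo_succ (j := j) (by omega)
  have u2 := L.lo_succ_lt_hi (j := j) (by omega)
  have u3 : L.hi j < L.hi (j + 1) :=
    (L.hi_lt_lo_add_two (by omega)).trans (L.lo_succ_lt_hi hj)
  have hp := L.depth_pos j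
  have hp' := L.depth_pos (j + 1)
  have hη := L.η_pos
  have hcase : j % 5 % 2 = 1 ∨ (j % 5 = 0 ∨ j % 5 = 2) ∨ j % 5 = 4 := by omega
  rcases hcase with hk | hk | hk
  · have e : (j + 1) % 5 % 2 = 0 := by omega
    refine ProperCross.symm (properCross_of_lt hp' hp ?_ ?_ ?_) <;>
      simp only [anchor, tip, if_neg h0, if_neg (Nat.succ_ne_zero j), e, hk] <;>
      norm_num
    · exact u2
    · nlinarith [mul_pos hp' (sub_pos.2 u1), mul_pos hp (sub_pos.2 (u2.trans u3))]
    · nlinarith [mul_pos hp' (sub_pos.2 (u1.trans u2)), mul_pos hp (sub_pos.2 u3)]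
  · have e : (j + 1) % 5 % 2 = 1 := by omega
    have e' : j % 5 % 2 = 0 := by omega
    have d : L.depth (j + 1) = L.depth j := by
      have h1 : ¬ j ≤ 1 := by omega
      have h2 : ¬ j + 1 ≤ 1 := by omega
      have h3 : ¬ j % 5 = 4 := by omega
      have h4 : ¬ (j + 1) % 5 = 4 := by omega
      simp only [depth, if_neg h1, if_neg h2, if_neg h3, if_neg h4]
    refine properCross_of_lt hp hp' ?_ ?_ ?_ <;>
      simp only [anchor, tip, if_neg h0, if_neg (Nat.succ_ne_zero j), e, e', d] <;>
      norm_num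
    · linarith
    · nlinarith [mul_pos hp (sub_pos.2 u2)]
    · nlinarith [mul_pos hp (sub_pos.2 u2)]
  · have e : (j + 1) % 5 % 2 = 0 := by omega
    have e' : j % 5 % 2 = 0 := by omega
    have d : L.depth j = L.η := by
      have h1 : ¬ j ≤ 1 := by omega
      simp only [depth, if_neg h1, if_pos hk]
    have d' : L.depth (j + 1) = 4 * L.η := by
      have h1 : ¬ j + 1 ≤ 1 := by omega
      have h2 : ¬ (j + 1) % 5 = 4 := by omega
      simp only [depth, if_neg h1, if_neg h2]
    have e1 : (j + 1) % 5 = 0 := by omega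
    have e2 : (j + 1) / 5 = j / 5 + 1 := by omega
    have hδ := L.δ_pos
    have w1 : L.lo (j + 1) = L.E (j / 5 + 1) - 3 * L.δ := by simp [lo, e1, e2]
    have w2 : L.hi (j + 1) = L.E (j / 5 + 1) := by simp [hi, e1, e2]
    have w3 : L.hi j = L.E (j / 5 + 1) - 2 * L.δ := by simp [hi, hk]
    refine properCross_of_lt hp hp' ?_ ?_ ?_ <;>
      simp only [anchor, tip, if_neg h0, if_neg (Nat.succ_ne_zero j), e, e', d, d'] <;>
      norm_num
    · exact u1
    · rw [w2, w3]
      rw [w1] at u1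
      nlinarith
    · rw [w1, w2, w3]
      nlinarith

theorem abs_fst_sub_le (i : Fin n) {p : ℝ × ℝ} (hp : p ∈ GSeg (a i) (b i) (c i))
    (h : -(4 * L.η) ≤ p.2) : |p.1 - L.A i| ≤ L.δ := by
  obtain ⟨t, h0, h1, h2, h3⟩ := mem_GSeg_iff.1 hp
  have hη := L.η_pos
  have hc : 0 < c i := by linarith [L.depth_lt i]
  rw [L.A_eq, h2, add_sub_cancel_left, abs_mul, abs_of_nonneg h0]
  have h4 : t * c i ≤ 4 * L.η := by linarith
  have h5 := mul_le_mul_of_nonneg_right h4 (abs_nonneg (b i - a i))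
  have h6 := L.drift_le i
  refine le_of_mul_le_mul_right ?_ hc
  linarith

theorem disjoint_of_ne (i : Fin n) {j : ℕ} (hj : j < 5 * n) (hij : j ≠ 5 * i + 4) :
    Disjoint (L.seg j) (GSeg (a i) (b i) (c i)) := by
  have hi' := i.2
  have hn : 0 < n := by omega
  have hδ := L.δ_pos
  have hc : 0 < c i := by linarith [L.depth_lt i, L.η_pos]
  rcases Nat.lt_trichotomy j 1 with h | rfl | h
  · obtain rfl : j = 0 := by omega
    refine L.disjoint_seg_zero hn fun p hp => ⟨?_, ?_⟩
    · have h1 := L.left_lt i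
      have h2 := L.le_right i
      exact (fst_mem_Icc_of_mem_GSeg hp ⟨h1.1.le, h2.1⟩ ⟨h1.2.le, h2.2⟩).2
    · linarith [neg_le_snd_of_mem_GSeg hp hc, L.le_C i]
  · rw [Set.disjoint_left]
    intro p hp hp'
    have h1 := (L.fst_mem_Icc one_ne_zero hj hp).2
    have h2 := (fst_mem_Icc_of_mem_GSeg hp' (r := max (a i) (b i))
      ⟨min_le_left _ _, le_max_left _ _⟩ ⟨min_le_right _ _, le_max_right _ _⟩).1
    have h3 := lt_min (L.left_lt i).1 (L.left_lt i).2
    simp only [hi] at h1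
    norm_num at h1
    linarith
  · rw [Set.disjoint_left]
    intro p hp hp'
    have h1 := L.fst_mem_Icc (by omega) hj hp
    have h2 : -(4 * L.η) ≤ p.2 := by
      linarith [neg_le_snd_of_mem_GSeg hp (L.depth_pos j), L.depth_le (show 2 ≤ j by omega)]
    have h3 := abs_le.1 (L.abs_fst_sub_le i hp' h2)
    have h4 := L.A_lt_E i hi'
    rcases lt_or_gt_of_ne hij with h5 | h5
    · have h6 := L.hi_mono (show j ≤ 5 * (i : ℕ) + 3 by omega) (by omega)
      have e : (5 * (i : ℕ) + 3) % 5 = 3 ∧ (5 * (i : ℕ) + 3) / 5 = i := by omega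
      have h7 : L.hi (5 * (i : ℕ) + 3) = L.A i - 3 * L.δ := by simp [hi, e]
      linarith [h1.2]
    · have h6 := L.lo_mono (show 5 * ((i : ℕ) + 1) ≤ j by omega) (by omega)
      have h7 : L.lo (5 * ((i : ℕ) + 1)) = L.E (i + 1) - 3 * L.δ := by simp [lo]
      linarith [h1.1]

theorem properCross_given (i : Fin n) :
    ProperCross (L.anchor (5 * i + 4)) (L.tip (5 * i + 4)) (L.depth (5 * i + 4))
      (a i) (b i) (c i) := by
  have e : (5 * (i : ℕ) + 4) % 5 = 4 ∧ (5 * (i : ℕ) + 4) / 5 = i := by omega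
  have hη := L.η_pos
  have hδ := L.δ_pos
  have h1 := L.depth_lt i
  have hc : 0 < c i := by linarith
  have h2 := L.A_lt_E i i.2
  have h3 := L.drift_le i
  have h4 : L.η * (b i - a i) ≤ L.δ * c i := by
    have := mul_le_mul_of_nonneg_left (le_abs_self (b i - a i)) hη.le
    nlinarith [mul_nonneg hη.le (abs_nonneg (b i - a i))]
  have h5 := mul_lt_mul_of_pos_right h2 hc
  have h6 := mul_pos hδ hc
  have h7 := mul_lt_mul_of_pos_left h1 hδ
  have h8 := mul_pos hδ hη
  rw [L.A_eq] at h2 h5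
  refine properCross_of_lt (L.depth_pos _) hc ?_ ?_ ?_ <;>
    simp [anchor, tip, depth, lo, hi, e, L.A_eq] <;> nlinarith

end CycleLayout

theorem exists_pos_forall_le {ι : Type*} [Finite ι] (f : ι → ℝ) (hf : ∀ i, 0 < f i) :
    ∃ ε, 0 < ε ∧ ∀ i, ε ≤ f i := by
  have h : ∀ᶠ ε in nhdsWithin (0 : ℝ) (Set.Ioi 0), 0 < ε ∧ ∀ i, ε ≤ f i := by
    refine Filter.Eventually.and self_mem_nhdsWithin (Filter.eventually_all.2 fun i => ?_)
    filter_upwards [Ioo_mem_nhdsGT (hf i)] with ε hε using hε.2.le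
  exact h.exists

theorem exists_forall_le {ι : Type*} [Finite ι] (f : ι → ℝ) : ∃ M, ∀ i, f i ≤ M := by
  obtain ⟨M, hM⟩ := (Set.finite_range f).bddAbove
  exact ⟨M, fun i => hM ⟨i, rfl⟩⟩

theorem nonempty_cycleLayout {n : ℕ} (hn : 0 < n) {a b c : Fin n → ℝ} (hc : ∀ i, 0 < c i)
    (ha : StrictMono a) : Nonempty (CycleLayout n a b c) := by
  obtain ⟨δ₀, hδ₀, hgap⟩ := exists_pos_forall_le
    (fun p : Fin n × Fin n => if p.1 < p.2 then a p.2 - a p.1 else 1) (by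
      intro p
      split_ifs with h
      · exact sub_pos.2 (ha h)
      · exact one_pos)
  set δ := min 1 (δ₀ / 20) with hδdef
  have hδ : 0 < δ := lt_min one_pos (by positivity)
  have hδ1 : δ ≤ 1 := min_le_left _ _
  have hδ2 : δ ≤ δ₀ / 20 := min_le_right _ _
  have hgap' : ∀ i j : Fin n, i < j → a i + 20 * δ ≤ a j := by
    intro i j hij
    have := hgap (i, j)
    simp only [if_pos hij] at this
    linarith
  obtain ⟨ε, hε, hεle⟩ := exists_pos_forall_le
    (fun i => min (c i) (δ * c i / (|b i - a i| + 1))) (fun i => by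
      have := hc i
      have := abs_nonneg (b i - a i)
      exact lt_min (hc i) (by positivity))
  obtain ⟨X, hX⟩ := exists_forall_le (fun i => max (a i) (b i))
  obtain ⟨Y, hY⟩ := exists_forall_le (fun i => max (-a i) (-b i))
  obtain ⟨C, hC⟩ := exists_forall_le c
  have hX' : ∀ i, a i ≤ X ∧ b i ≤ X := fun i => max_le_iff.1 (hX i)
  have hY' : ∀ i, -Y ≤ a i ∧ -Y ≤ b i := fun i => by
    have := max_le_iff.1 (hY i)
    constructor <;> linarith
  have hC0 : 0 < C := (hc ⟨0, hn⟩).trans_le (hC _)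
  have hXY : -Y ≤ X := (hY' ⟨0, hn⟩).1.trans (hX' ⟨0, hn⟩).1
  set W := X + Y + 20 - δ with hW
  have hW0 : 0 < W := by rw [hW]; linarith
  exact ⟨{
    A := fun i => if h : i < n then a ⟨i, h⟩ else 0
    E := fun i => if i = 0 then -Y - 10 else if h : i < n then a ⟨i, h⟩ - 10 * δ else X + 10
    δ := δ
    η := ε / 8
    X := X
    C := C
    D := C * W
    δ_pos := hδ
    η_pos := by positivity
    D_pos := by positivity
    A_eq := fun i => by simp
    E_lt_A := by
      intro i hi
      have := (hY' ⟨i, hi⟩).1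
      simp only [dif_pos hi]
      split_ifs <;> linarith
    A_lt_E := by
      intro i hi
      have := (hX' ⟨i, hi⟩).1
      simp only [dif_pos hi, if_neg (Nat.succ_ne_zero i)]
      split_ifs with h
      · have := hgap' ⟨i, hi⟩ ⟨i + 1, h⟩ (by simp)
        linarith
      · linarith
    depth_lt := fun i => by
      have := (hεle i).trans (min_le_left _ _)
      linarith
    drift_le := fun i => by
      have h := (hεle i).trans (min_le_right _ _)
      have h0 := abs_nonneg (b i - a i)
      rw [le_div_iff₀ (by positivity)] at h
      nlinarith [mul_nonneg hε.le h0]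
    left_lt := fun i => by
      have := hY' i
      simp only [if_true]
      constructor <;> linarith
    le_right := hX'
    right_lt := by
      simp [hn.ne']
      linarith
    le_C := hC
    lt_D := by
      simp only [if_true, if_neg hn.ne', lt_irrefl, dite_false]
      have e : X + 10 - (-Y - 10) - δ = W := by rw [hW]; ring
      have := mul_pos hC0 hW0
      rw [e]
      nlinarith }⟩

/-- The graph obtained from `G` by adding a cycle on `5 * n` vertices whose vertex `5 * i + 4` is
joined to the vertex `i` of `G`. -/
def cycleExtensionGraph {n : ℕ} (G : SimpleGraph (Fin n)) :
    SimpleGraph (Fin n ⊕ Fin (5 * n)) where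
  Adj
    | Sum.inl i, Sum.inl j => G.Adj i j
    | Sum.inr i, Sum.inr j => (i.val + 1) % (5 * n) = j.val ∨ (j.val + 1) % (5 * n) = i.val
    | Sum.inl i, Sum.inr j => j.val = 5 * i.val + 4
    | Sum.inr j, Sum.inl i => j.val = 5 * i.val + 4
  symm := ⟨by
    rintro (i | i) (j | j) h
    · exact G.adj_symm h
    · exact h
    · exact h
    · exact h.symm⟩
  loopless := ⟨by
    rintro (i | i) h
    · exact G.irrefl h
    · have h' : (i.val + 1) % (5 * n) = i.val := or_self_iff.1 h
      have hi := i.2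
      rcases Nat.lt_or_ge (i.val + 1) (5 * n) with hlt | hge
      · rw [Nat.mod_eq_of_lt hlt] at h'
        omega
      · rw [show i.val + 1 = 5 * n by omega, Nat.mod_self] at h'
        omega⟩

theorem isCycleExtension_cycleExtensionGraph {n : ℕ} (G : SimpleGraph (Fin n)) :
    IsCycleExtension n G (cycleExtensionGraph G) :=
  ⟨fun _ _ => Iff.rfl, fun _ _ => Iff.rfl, fun _ => Or.inl fun _ => Iff.rfl⟩

theorem succ_mod_eq_or_iff {m j k : ℕ} (hjk : j < k) (hk : k < m) :
    ((j + 1) % m = k ∨ (k + 1) % m = j) ↔ (j + 1 = k ∨ (j = 0 ∧ k + 1 = m)) := by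
  rw [Nat.mod_eq_of_lt (by omega)]
  rcases Nat.lt_or_ge (k + 1) m with h | h
  · rw [Nat.mod_eq_of_lt h]
    omega
  · rw [show k + 1 = m by omega, Nat.mod_self]
    omega

theorem CycleLayout.crossing_or_disjoint {n : ℕ} {a b c : Fin n → ℝ} (L : CycleLayout n a b c)
    {j k : ℕ} (hjk : j < k) (hk : k < 5 * n) :
    (((j + 1) % (5 * n) = k ∨ (k + 1) % (5 * n) = j) → L.Crossing j k) ∧
    (¬ ((j + 1) % (5 * n) = k ∨ (k + 1) % (5 * n) = j) → Disjoint (L.seg j) (L.seg k)) := by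
  rw [succ_mod_eq_or_iff hjk hk]
  constructor
  · rintro (rfl | ⟨rfl, h⟩)
    · rcases Nat.eq_zero_or_pos j with rfl | hj
      · exact L.crossing_zero_one (by omega)
      · exact L.crossing_succ hj.ne' hk
    · rw [show k = 5 * n - 1 by omega]
      exact L.crossing_zero_last (by omega)
  · intro h
    rcases Nat.eq_zero_or_pos j with rfl | hj
    · exact L.disjoint_seg_zero_seg (by omega) (by omega)
    · exact L.disjoint_seg hj.ne' (by omega) hk

/-- Every grounded segment representation of a graph `G` on `Fin n`
inducing the natural order can be extended (keeping the segments of the original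
vertices) to a grounded segment representation of some cycle extension `H` of `G`. -/
theorem extend_groundedSeg_to_cycle_extension (n : ℕ) (G : SimpleGraph (Fin n))
    (R : GroundedSegRep G) (hord : ∀ i j : Fin n, i < j ↔ R.a i < R.a j) :
    ∃ H : SimpleGraph (Fin n ⊕ Fin (5 * n)), IsCycleExtension n G H ∧
      ∃ R' : GroundedSegRep H, ∀ i : Fin n,
        R'.a (Sum.inl i) = R.a i ∧ R'.b (Sum.inl i) = R.b i ∧
        R'.c (Sum.inl i) = R.c i := by
  refine ⟨cycleExtensionGraph G, isCycleExtension_cycleExtensionGraph G, ?_⟩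
  rcases Nat.eq_zero_or_pos n with rfl | hn
  · exact ⟨GroundedSegRep.ofProperCross (fun _ => 0) (fun _ => 0) (fun _ => 1)
      (fun _ => one_pos) (fun u => by rcases u with u | u <;> exact u.elim0)
      (fun u => by rcases u with u | u <;> exact u.elim0), fun i => i.elim0⟩
  obtain ⟨L⟩ := nonempty_cycleLayout (b := R.b) hn R.c_pos (fun i j h => (hord i j).1 h)
  refine ⟨GroundedSegRep.ofProperCross
    (Sum.elim R.a fun j => L.anchor j) (Sum.elim R.b fun j => L.tip j)
    (Sum.elim R.c fun j => L.depth j) ?_ ?_ ?_, fun i => ⟨rfl, rfl, rfl⟩⟩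
  · rintro (i | j)
    · exact R.c_pos i
    · exact L.depth_pos j
  · rintro (i | j) (k | k) h
    · have hne : i ≠ k := G.ne_of_adj h
      exact ⟨R.a_inj.ne hne, (R.adj_iff i k hne).1 h, (R.endpoints_off i k hne).2,
        (R.endpoints_off k i hne.symm).2⟩
    · have h' : k.val = 5 * i.val + 4 := h
      simp only [Sum.elim_inl, Sum.elim_inr, h']
      exact (L.properCross_given i).symm
    · have h' : j.val = 5 * k.val + 4 := h
      simp only [Sum.elim_inl, Sum.elim_inr, h']
      exact L.properCross_given k
    · have hne : j.val ≠ k.val := fun e => (cycleExtensionGraph G).ne_of_adj h (by rw [Fin.ext e])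
      rcases lt_or_gt_of_ne hne with hlt | hlt
      · exact (L.crossing_or_disjoint hlt k.2).1 h
      · exact ((L.crossing_or_disjoint hlt j.2).1 h.symm).symm
  · rintro (i | j) (k | k) hne h
    · rw [Set.disjoint_iff_inter_eq_empty, ← Set.not_nonempty_iff_eq_empty]
      have hne' : i ≠ k := fun e => hne (by rw [e])
      exact fun h' => h ((R.adj_iff i k hne').2 h')
    · exact (L.disjoint_of_ne i k.2 h).symm
    · exact L.disjoint_of_ne k j.2 h
    · have hne' : j.val ≠ k.val := fun e => hne (by rw [Fin.ext e])
      rcases lt_or_gt_of_ne hne' with hlt | hlt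
      · exact (L.crossing_or_disjoint hlt k.2).2 h
      · exact ((L.crossing_or_disjoint hlt j.2).2 fun h' => h h'.symm).symm
end

section
/- Let G be a finite simple graph with vertices x_1, …, x_n and suppose a monotone L-representation (Mpt representation) of G is given, inducing the order x_1 < ⋯ < x_n. Then there exist a cycle extension H of (G,<) and a monotone L-representation of H whose restriction to the vertices x_1, …, x_n coincides with the given representation of G. -/
/-- The shape of a monotone L-representation: the union of the vertical segment
from `(p, q)` to `(p, q + h)` and the horizontal segment from `(p, q)` to `(p + w, q)`. -/
def MShape (p q h w : ℝ) : Set (ℝ × ℝ) :=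
  segment ℝ ((p, q) : ℝ × ℝ) ((p, q + h) : ℝ × ℝ) ∪
    segment ℝ ((p, q) : ℝ × ℝ) ((p + w, q) : ℝ × ℝ)

/-- A monotone L-representation (Mpt representation) of a simple graph `G`:
all bends lie on a common downward-sloping line. -/
structure MptRep {V : Type} (G : SimpleGraph V) where
  p : V → ℝ
  q : V → ℝ
  ht : V → ℝ
  wd : V → ℝ
  ht_pos : ∀ v, 0 < ht v
  wd_pos : ∀ v, 0 < wd v
  line : ∃ m c : ℝ, m < 0 ∧ ∀ v, q v = m * p v + c
  p_inj : Function.Injective p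
  endpoints_off : ∀ u v, u ≠ v →
    ((p v, q v + ht v) : ℝ × ℝ) ∉ MShape (p u) (q u) (ht u) (wd u) ∧
    ((p v + wd v, q v) : ℝ × ℝ) ∉ MShape (p u) (q u) (ht u) (wd u)
  adj_iff : ∀ u v, u ≠ v →
    (G.Adj u v ↔ (MShape (p u) (q u) (ht u) (wd u) ∩ MShape (p v) (q v) (ht v) (wd v)).Nonempty)

theorem mem_MShape {p q h w x y : ℝ} (hh : 0 ≤ h) (hw : 0 ≤ w) :
    (x, y) ∈ MShape p q h w ↔
      (x = p ∧ q ≤ y ∧ y ≤ q + h) ∨ (y = q ∧ p ≤ x ∧ x ≤ p + w) := by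
  unfold MShape
  rw [← Prod.image_mk_segment_right, ← Prod.image_mk_segment_left,
    segment_eq_Icc (by linarith), segment_eq_Icc (by linarith)]
  simp only [Set.mem_union, Set.mem_image, Set.mem_Icc, Prod.mk.injEq]
  constructor
  · rintro (⟨z, hz, rfl, rfl⟩ | ⟨z, hz, rfl, rfl⟩)
    · exact Or.inl ⟨rfl, hz⟩
    · exact Or.inr ⟨rfl, hz⟩
  · rintro (⟨rfl, hz⟩ | ⟨rfl, hz⟩)
    · exact Or.inl ⟨y, hz, rfl, rfl⟩
    · exact Or.inr ⟨x, hz, rfl, rfl⟩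

section Shape

variable {m c p p' h h' w w' : ℝ}

theorem add_div_le_iff_of_neg (hm : m < 0) : p' + h' / m ≤ p ↔ m * p ≤ m * p' + h' := by
  have e : m * (h' / m) = h' := mul_div_cancel₀ _ hm.ne
  constructor <;> intro H <;> nlinarith

theorem add_div_eq_iff_of_neg (hm : m < 0) : p' + h' / m = p ↔ m * p = m * p' + h' := by
  have e : m * p' + h' = m * (p' + h' / m) := by
    rw [mul_add, mul_div_cancel₀ _ hm.ne]
  rw [e, mul_right_inj' hm.ne, eq_comm]

theorem MShape_inter_nonempty_iff (hm : m < 0) (hh : 0 < h) (hw : 0 < w) (hh' : 0 < h')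
    (hw' : 0 < w') (hp : p < p') :
    (MShape p (m * p + c) h w ∩ MShape p' (m * p' + c) h' w').Nonempty ↔
      p' ≤ p + w ∧ p' + h' / m ≤ p := by
  rw [add_div_le_iff_of_neg hm]
  have hq : m * p' < m * p := mul_lt_mul_of_neg_left hp hm
  constructor
  · rintro ⟨⟨x, y⟩, h1, h2⟩
    rw [mem_MShape hh.le hw.le] at h1
    rw [mem_MShape hh'.le hw'.le] at h2
    rcases h1 with ⟨_, _, _⟩ | ⟨_, _, _⟩ <;> rcases h2 with ⟨_, _, _⟩ | ⟨_, _, _⟩ <;>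
      constructor <;> linarith
  · rintro ⟨h1, h2⟩
    refine ⟨(p', m * p + c), ?_, ?_⟩
    · exact (mem_MShape hh.le hw.le).2 (Or.inr ⟨rfl, hp.le, h1⟩)
    · exact (mem_MShape hh'.le hw'.le).2 (Or.inl ⟨rfl, by linarith, by linarith⟩)

theorem top_mem_MShape_iff (hm : m < 0) (hh : 0 < h) (hw : 0 < w) (hp : p ≠ p') :
    (p', m * p' + c + h') ∈ MShape p (m * p + c) h w ↔
      p < p' ∧ p' + h' / m = p ∧ p' ≤ p + w := by
  rw [mem_MShape hh.le hw.le, add_div_eq_iff_of_neg hm]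
  constructor
  · rintro (⟨e, _⟩ | ⟨e, h1, h2⟩)
    · exact absurd e.symm hp
    · exact ⟨lt_of_le_of_ne h1 hp, by linarith, h2⟩
  · rintro ⟨h1, h2, h3⟩
    exact Or.inr ⟨by linarith, h1.le, h3⟩

theorem right_mem_MShape_iff (hm : m < 0) (hh : 0 < h) (hw : 0 < w) (hw' : 0 < w') (hp : p ≠ p') :
    (p' + w', m * p' + c) ∈ MShape p (m * p + c) h w ↔
      p' < p ∧ p' + w' = p ∧ p + h / m ≤ p' := by
  rw [mem_MShape hh.le hw.le, add_div_le_iff_of_neg hm]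
  constructor
  · rintro (⟨e, h1, h2⟩ | ⟨e, _⟩)
    · exact ⟨by linarith, e, by linarith⟩
    · exact absurd (mul_left_cancel₀ hm.ne (by linarith : m * p = m * p')) hp
  · rintro ⟨h1, h2, h3⟩
    have hq : m * p < m * p' := mul_lt_mul_of_neg_left h1 hm
    exact Or.inl ⟨h2, by linarith, by linarith⟩

end Shape

/-- The max point-tolerance graph of points `p v` lying in intervals `[l v, r v]`: two vertices are
adjacent when each of the two intervals contains both points. -/
def pointIntervalGraph {V : Type} (p l r : V → ℝ) : SimpleGraph V where
  Adj u v := u ≠ v ∧ p u ∈ Set.Icc (l v) (r v) ∧ p v ∈ Set.Icc (l u) (r u)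
  symm := ⟨fun _ _ h => ⟨h.1.symm, h.2.2, h.2.1⟩⟩
  loopless := ⟨fun _ h => h.1 rfl⟩

theorem pointIntervalGraph_adj_iff_of_lt {V : Type} {p l r : V → ℝ} (hl : ∀ v, l v < p v)
    (hr : ∀ v, p v < r v) {u v : V} (huv : p u < p v) :
    (pointIntervalGraph p l r).Adj u v ↔ p v ≤ r u ∧ l v ≤ p u := by
  have hne : u ≠ v := by rintro rfl; exact huv.false
  have := hl u
  have := hr v
  constructor
  · rintro ⟨_, h1, h2⟩
    exact ⟨h2.2, h1.1⟩
  · rintro ⟨h1, h2⟩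
    exact ⟨hne, ⟨h2, by linarith⟩, ⟨by linarith, h1⟩⟩

/-- A point-interval system in general position is a monotone L-representation after
placing the bends on a prescribed downward-sloping line. -/
def pointIntervalRep {V : Type} {p l r : V → ℝ} {m : ℝ} (c : ℝ) (hm : m < 0)
    (hp : Function.Injective p) (hl : ∀ v, l v < p v) (hr : ∀ v, p v < r v)
    (left_off : ∀ u v, p u < p v → l v = p u → ¬ p v ≤ r u)
    (right_off : ∀ u v, p u < p v → r u = p v → ¬ l v ≤ p u) :
    MptRep (pointIntervalGraph p l r) where
  p := p
  q v := m * p v + c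
  ht v := m * (l v - p v)
  wd v := r v - p v
  ht_pos v := mul_pos_of_neg_of_neg hm (sub_neg.2 (hl v))
  wd_pos v := sub_pos.2 (hr v)
  line := ⟨m, c, hm, fun _ => rfl⟩
  p_inj := hp
  endpoints_off u v huv := by
    have hh : ∀ v, 0 < m * (l v - p v) := fun v => mul_pos_of_neg_of_neg hm (sub_neg.2 (hl v))
    have hw : ∀ v, 0 < r v - p v := fun v => sub_pos.2 (hr v)
    rw [top_mem_MShape_iff hm (hh u) (hw u) (hp.ne huv),
      right_mem_MShape_iff hm (hh u) (hw u) (hw v) (hp.ne huv)]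
    simp only [mul_div_cancel_left₀ _ hm.ne, add_sub_cancel]
    exact ⟨fun h => left_off u v h.1 h.2.1 h.2.2, fun h => right_off v u h.1 h.2.1 h.2.2⟩
  adj_iff u v huv := by
    have hh : ∀ v, 0 < m * (l v - p v) := fun v => mul_pos_of_neg_of_neg hm (sub_neg.2 (hl v))
    have hw : ∀ v, 0 < r v - p v := fun v => sub_pos.2 (hr v)
    rcases (hp.ne huv).lt_or_gt with h | h
    · rw [MShape_inter_nonempty_iff hm (hh u) (hw u) (hh v) (hw v) h,
        pointIntervalGraph_adj_iff_of_lt hl hr h]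
      simp only [mul_div_cancel_left₀ _ hm.ne, add_sub_cancel]
    · rw [Set.inter_comm, MShape_inter_nonempty_iff hm (hh v) (hw v) (hh u) (hw u) h,
        SimpleGraph.adj_comm, pointIntervalGraph_adj_iff_of_lt hl hr h]
      simp only [mul_div_cancel_left₀ _ hm.ne, add_sub_cancel]

theorem exists_pos_forall_lt {ι : Type*} [Finite ι] (f : ι → ℝ) (hf : ∀ i, 0 < f i) :
    ∃ δ > 0, ∀ i, δ < f i := by
  have h : ∀ᶠ δ in nhdsWithin (0 : ℝ) (Set.Ioi 0), ∀ i, δ < f i :=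
    Filter.eventually_all.2 fun i => nhdsWithin_le_nhds (eventually_lt_nhds (hf i))
  obtain ⟨δ, h1, h2⟩ := (h.and self_mem_nhdsWithin).exists
  exact ⟨δ, h2, h1⟩

/-- Points `X i` with intervals `[L i, U i]`, a scale `δ` fine enough to separate
all of them, and bounds `A`, `B` beyond all the intervals. -/
structure SeparatedIntervals (n : ℕ) (X L U : ℕ → ℝ) (δ A B : ℝ) : Prop where
  pos : 0 < δ
  gap : ∀ i, i + 1 < n → X i + 20 * δ ≤ X (i + 1)
  left : ∀ i < n, L i + 10 * δ ≤ X i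
  right : ∀ i < n, X i + 10 * δ ≤ U i
  lower : ∀ i < n, A + δ < L i
  upper : ∀ i < n, U i + δ < B

/-- Offsets of the five cycle vertices around a given point. -/
def cycleOffset : ℕ → ℝ
  | 0 => -6
  | 1 => -4
  | 2 => -2
  | 3 => 2
  | _ => 4

/-- Positions of the cycle vertices, from left to right. -/
noncomputable def cyclePos (n : ℕ) (X : ℕ → ℝ) (δ A B : ℝ) (k : ℕ) : ℝ :=
  if k = 0 then A else if k + 1 = 5 * n then B else X (k / 5) + δ * cycleOffset (k % 5)

/-- Left ends of the intervals of the cycle vertices. -/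
noncomputable def cycleLeft (n : ℕ) (X : ℕ → ℝ) (δ A B : ℝ) (k : ℕ) : ℝ :=
  if k = 0 ∨ k + 1 = 5 * n then A - δ else cyclePos n X δ A B (k - 1) - δ

/-- Right ends of the intervals of the cycle vertices. -/
noncomputable def cycleRight (n : ℕ) (X : ℕ → ℝ) (δ A B : ℝ) (k : ℕ) : ℝ :=
  if k = 0 ∨ k + 1 = 5 * n then B + δ else cyclePos n X δ A B (k + 1) + δ

namespace SeparatedIntervals

variable {n : ℕ} {X L U : ℕ → ℝ} {δ A B : ℝ}

theorem cyclePos_zero : cyclePos n X δ A B 0 = A := by simp [cyclePos]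

theorem cyclePos_last {k : ℕ} (hk : k + 1 = 5 * n) : cyclePos n X δ A B k = B := by
  have : k ≠ 0 := by omega
  simp [cyclePos, hk, this]

theorem cyclePos_before (i : ℕ) : cyclePos n X δ A B (5 * i + 2) = X i - 2 * δ := by
  have h1 : 5 * i + 2 + 1 ≠ 5 * n := by omega
  have h2 : (5 * i + 2) / 5 = i := by omega
  have h3 : (5 * i + 2) % 5 = 2 := by omega
  simp only [cyclePos, h1, h2, h3, cycleOffset]
  simp
  ring

theorem cyclePos_after (i : ℕ) : cyclePos n X δ A B (5 * i + 3) = X i + 2 * δ := by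
  have h1 : 5 * i + 3 + 1 ≠ 5 * n := by omega
  have h2 : (5 * i + 3) / 5 = i := by omega
  have h3 : (5 * i + 3) % 5 = 3 := by omega
  simp only [cyclePos, h1, h2, h3, cycleOffset]
  simp
  ring

theorem cyclePos_step (S : SeparatedIntervals n X L U δ A B) {k : ℕ} (hk : k + 1 < 5 * n) :
    cyclePos n X δ A B k + 2 * δ ≤ cyclePos n X δ A B (k + 1) := by
  obtain ⟨i, r, hr, rfl⟩ : ∃ i r, r < 5 ∧ k = 5 * i + r := ⟨k / 5, k % 5, by omega, by omega⟩
  have hi : i < n := by omega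
  have h0 := S.pos
  have h1 := S.left i hi
  have h2 := S.right i hi
  have h3 := S.lower i hi
  have h4 := S.upper i hi
  have e : (5 * i + r + 1) / 5 = if r = 4 then i + 1 else i := by split_ifs <;> omega
  have e' : (5 * i + r + 1) % 5 = if r = 4 then 0 else r + 1 := by split_ifs <;> omega
  have f : (5 * i + r) / 5 = i := by omega
  have f' : (5 * i + r) % 5 = r := by omega
  have g : 5 * i + r + 1 ≠ 5 * n := by omega
  have g' : 5 * i + r + 1 ≠ 0 := by omega
  simp only [cyclePos, e, e', f, f', g, g', if_false]
  have step : i + 1 < n → X i + 20 * δ ≤ X (i + 1) := S.gap i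
  interval_cases r <;> split_ifs <;>
    first
      | contradiction
      | omega
      | (simp only [cycleOffset, Nat.reduceAdd]; linarith)
      | (have := step (by omega); simp only [cycleOffset]; linarith)

theorem cyclePos_lt (S : SeparatedIntervals n X L U δ A B) {k k' : ℕ} (h : k < k')
    (hk : k' < 5 * n) : cyclePos n X δ A B k + 2 * δ ≤ cyclePos n X δ A B k' := by
  induction k', h using Nat.le_induction with
  | base => exact S.cyclePos_step hk
  | succ j hj ih =>
    have := ih (by omega)
    have := S.cyclePos_step hk
    have := S.pos
    linarith

theorem cyclePos_le (S : SeparatedIntervals n X L U δ A B) {k k' : ℕ} (h : k ≤ k')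
    (hk : k' < 5 * n) : cyclePos n X δ A B k ≤ cyclePos n X δ A B k' := by
  rcases h.eq_or_lt with rfl | h
  · rfl
  · have := S.cyclePos_lt h hk
    have := S.pos
    linarith

theorem cyclePos_le_sub (S : SeparatedIntervals n X L U δ A B) {i k : ℕ} (hi : i < n)
    (h : k ≤ 5 * i + 2) : cyclePos n X δ A B k ≤ X i - 2 * δ :=
  cyclePos_before (n := n) (δ := δ) (A := A) (B := B) i ▸ S.cyclePos_le h (by omega)

theorem add_le_cyclePos (S : SeparatedIntervals n X L U δ A B) {i k : ℕ} (hk : k < 5 * n)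
    (h : 5 * i + 3 ≤ k) : X i + 2 * δ ≤ cyclePos n X δ A B k :=
  cyclePos_after (n := n) (δ := δ) (A := A) (B := B) i ▸ S.cyclePos_le h hk

theorem cycleLeft_cases (n : ℕ) (X : ℕ → ℝ) (δ A B : ℝ) (k : ℕ) :
    ((k = 0 ∨ k + 1 = 5 * n) ∧ cycleLeft n X δ A B k = A - δ) ∨
      (k ≠ 0 ∧ k + 1 ≠ 5 * n ∧ cycleLeft n X δ A B k = cyclePos n X δ A B (k - 1) - δ) := by
  unfold cycleLeft
  split_ifs with h
  · exact Or.inl ⟨h, rfl⟩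
  · push Not at h
    exact Or.inr ⟨h.1, h.2, rfl⟩

theorem cycleRight_cases (n : ℕ) (X : ℕ → ℝ) (δ A B : ℝ) (k : ℕ) :
    ((k = 0 ∨ k + 1 = 5 * n) ∧ cycleRight n X δ A B k = B + δ) ∨
      (k ≠ 0 ∧ k + 1 ≠ 5 * n ∧ cycleRight n X δ A B k = cyclePos n X δ A B (k + 1) + δ) := by
  unfold cycleRight
  split_ifs with h
  · exact Or.inl ⟨h, rfl⟩
  · push Not at h
    exact Or.inr ⟨h.1, h.2, rfl⟩

theorem lower_le_cyclePos (S : SeparatedIntervals n X L U δ A B) {k : ℕ} (hk : k < 5 * n) :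
    A ≤ cyclePos n X δ A B k :=
  cyclePos_zero (n := n) (X := X) (δ := δ) (A := A) (B := B) ▸ S.cyclePos_le (Nat.zero_le k) hk

theorem cyclePos_le_upper (S : SeparatedIntervals n X L U δ A B) {k : ℕ} (hk : k < 5 * n) :
    cyclePos n X δ A B k ≤ B := by
  have h : 5 * n - 1 + 1 = 5 * n := by omega
  exact (S.cyclePos_le (by omega : k ≤ 5 * n - 1) (by omega)).trans_eq (cyclePos_last h)

theorem cycleLeft_lt (S : SeparatedIntervals n X L U δ A B) {k : ℕ} (hk : k < 5 * n) :
    cycleLeft n X δ A B k < cyclePos n X δ A B k := by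
  have := S.pos
  rcases cycleLeft_cases n X δ A B k with ⟨_, e⟩ | ⟨h, _, e⟩
  · linarith [S.lower_le_cyclePos hk]
  · linarith [S.cyclePos_le (Nat.sub_le k 1) hk]

theorem lt_cycleRight (S : SeparatedIntervals n X L U δ A B) {k : ℕ} (hk : k < 5 * n) :
    cyclePos n X δ A B k < cycleRight n X δ A B k := by
  have := S.pos
  rcases cycleRight_cases n X δ A B k with ⟨_, e⟩ | ⟨_, _, e⟩
  · linarith [S.cyclePos_le_upper hk]
  · linarith [S.cyclePos_le (Nat.le_succ k) (by omega)]

theorem cyclePos_injOn (S : SeparatedIntervals n X L U δ A B) {k k' : ℕ} (hk : k < 5 * n)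
    (hk' : k' < 5 * n) (h : cyclePos n X δ A B k = cyclePos n X δ A B k') : k = k' := by
  have := S.pos
  rcases lt_trichotomy k k' with hlt | rfl | hlt
  · linarith [S.cyclePos_lt hlt hk']
  · rfl
  · linarith [S.cyclePos_lt hlt hk]

theorem cyclePos_ne_center (S : SeparatedIntervals n X L U δ A B) {i k : ℕ} (hi : i < n)
    (hk : k < 5 * n) : cyclePos n X δ A B k ≠ X i := by
  have := S.pos
  rcases le_or_gt k (5 * i + 2) with h | h
  · linarith [S.cyclePos_le_sub hi h]
  · linarith [S.add_le_cyclePos hk h]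

theorem cycleLeft_ne_cyclePos (S : SeparatedIntervals n X L U δ A B) {k k' : ℕ} (hk : k < 5 * n)
    (hk' : k' < 5 * n) : cycleLeft n X δ A B k ≠ cyclePos n X δ A B k' := by
  have := S.pos
  rcases cycleLeft_cases n X δ A B k with ⟨_, e⟩ | ⟨_, _, e⟩
  · linarith [S.lower_le_cyclePos hk']
  · rcases le_or_gt (k - 1) k' with h | h
    · linarith [S.cyclePos_le h hk']
    · linarith [S.cyclePos_lt h (by omega)]

theorem cycleRight_ne_cyclePos (S : SeparatedIntervals n X L U δ A B) {k k' : ℕ} (hk : k < 5 * n)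
    (hk' : k' < 5 * n) : cycleRight n X δ A B k ≠ cyclePos n X δ A B k' := by
  have := S.pos
  rcases cycleRight_cases n X δ A B k with ⟨_, e⟩ | ⟨_, _, e⟩
  · linarith [S.cyclePos_le_upper hk']
  · rcases le_or_gt k' (k + 1) with h | h
    · linarith [S.cyclePos_le h (by omega)]
    · linarith [S.cyclePos_lt h hk']

theorem cycleLeft_ne_center (S : SeparatedIntervals n X L U δ A B) {i k : ℕ} (hi : i < n)
    (hk : k < 5 * n) : cycleLeft n X δ A B k ≠ X i := by
  have := S.pos
  rcases cycleLeft_cases n X δ A B k with ⟨_, e⟩ | ⟨_, _, e⟩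
  · linarith [S.lower i hi, S.left i hi]
  · rcases le_or_gt (k - 1) (5 * i + 2) with h | h
    · linarith [S.cyclePos_le_sub hi h]
    · linarith [S.add_le_cyclePos (by omega) h]

theorem cycleRight_ne_center (S : SeparatedIntervals n X L U δ A B) {i k : ℕ} (hi : i < n)
    (hk : k < 5 * n) : cycleRight n X δ A B k ≠ X i := by
  have := S.pos
  rcases cycleRight_cases n X δ A B k with ⟨_, e⟩ | ⟨_, _, e⟩
  · linarith [S.upper i hi, S.right i hi]
  · rcases le_or_gt (k + 1) (5 * i + 2) with h | h
    · linarith [S.cyclePos_le_sub hi h]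
    · linarith [S.add_le_cyclePos (by omega) h]

/-- Apart from the two extreme cycle vertices, only the two vertices next to `X i` have
an interval containing `X i`. -/
theorem near_of_center_mem (S : SeparatedIntervals n X L U δ A B) {i k : ℕ} (hi : i < n)
    (hk : k < 5 * n) (hl : cycleLeft n X δ A B k ≤ X i) (hr : X i ≤ cycleRight n X δ A B k) :
    k = 0 ∨ k + 1 = 5 * n ∨ k = 5 * i + 2 ∨ k = 5 * i + 3 := by
  have := S.pos
  rcases cycleLeft_cases n X δ A B k with ⟨h, e⟩ | ⟨_, _, e⟩
  · omega
  rcases cycleRight_cases n X δ A B k with ⟨h, e'⟩ | ⟨_, _, e'⟩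
  · omega
  by_contra! hne
  rcases le_or_gt k (5 * i + 2) with h | h
  · linarith [S.cyclePos_le_sub hi (by omega : k + 1 ≤ 5 * i + 2)]
  · linarith [S.add_le_cyclePos (i := i) (by omega : k - 1 < 5 * n) (by omega)]

theorem far_of_extreme (S : SeparatedIntervals n X L U δ A B) {i k : ℕ} (hi : i < n)
    (hk : k = 0 ∨ k + 1 = 5 * n) :
    cyclePos n X δ A B k < L i ∨ U i < cyclePos n X δ A B k := by
  have := S.pos
  rcases hk with rfl | hk
  · left
    rw [cyclePos_zero]
    linarith [S.lower i hi]
  · right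
    rw [cyclePos_last hk]
    linarith [S.upper i hi]

theorem inside_of_near (S : SeparatedIntervals n X L U δ A B) {i k : ℕ} (hi : i < n)
    (hk : k = 5 * i + 2 ∨ k = 5 * i + 3) :
    L i < cyclePos n X δ A B k ∧ cyclePos n X δ A B k < U i := by
  have := S.pos
  have := S.left i hi
  have := S.right i hi
  rcases hk with rfl | rfl
  · rw [cyclePos_before i]
    constructor <;> linarith
  · rw [cyclePos_after i]
    constructor <;> linarith

theorem center_adj_iff (S : SeparatedIntervals n X L U δ A B) {i k : ℕ} (hi : i < n)
    (hk : k < 5 * n) :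
    (X i ∈ Set.Icc (cycleLeft n X δ A B k) (cycleRight n X δ A B k) ∧
      cyclePos n X δ A B k ∈ Set.Icc (L i) (U i)) ↔ k = 5 * i + 2 ∨ k = 5 * i + 3 := by
  constructor
  · rintro ⟨⟨h1, h2⟩, h3, h4⟩
    rcases S.near_of_center_mem hi hk h1 h2 with h | h | h
    · rcases S.far_of_extreme hi (Or.inl h) <;> linarith
    · rcases S.far_of_extreme hi (Or.inr h) <;> linarith
    · exact h
  · intro h
    have hin := S.inside_of_near hi h
    refine ⟨⟨?_, ?_⟩, hin.1.le, hin.2.le⟩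
    · have := S.pos
      rcases cycleLeft_cases n X δ A B k with ⟨_, e⟩ | ⟨_, _, e⟩
      · omega
      · linarith [S.cyclePos_le_sub hi (by omega : k - 1 ≤ 5 * i + 2)]
    · have := S.pos
      rcases cycleRight_cases n X δ A B k with ⟨_, e⟩ | ⟨_, _, e⟩
      · omega
      · linarith [S.add_le_cyclePos (i := i) (by omega : k + 1 < 5 * n) (by omega)]

theorem cycle_adj_iff_of_lt (S : SeparatedIntervals n X L U δ A B) {k k' : ℕ} (h : k < k')
    (hk : k' < 5 * n) :
    (cyclePos n X δ A B k' ≤ cycleRight n X δ A B k ∧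
      cycleLeft n X δ A B k' ≤ cyclePos n X δ A B k) ↔
      k' = k + 1 ∨ (k = 0 ∧ k' + 1 = 5 * n) := by
  have := S.pos
  constructor
  · rintro ⟨h1, h2⟩
    by_contra! hne
    rcases cycleRight_cases n X δ A B k with ⟨h, e⟩ | ⟨_, _, e⟩
    · rcases cycleLeft_cases n X δ A B k' with ⟨_, e'⟩ | ⟨_, _, e'⟩
      · omega
      · linarith [S.cyclePos_lt (by omega : k < k' - 1) (by omega)]
    · linarith [S.cyclePos_lt (by omega : k + 1 < k') hk]
  · rintro (rfl | ⟨rfl, hlast⟩)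
    · constructor
      · rcases cycleRight_cases n X δ A B k with ⟨_, e⟩ | ⟨_, _, e⟩
        · linarith [S.cyclePos_le_upper hk]
        · linarith
      · rcases cycleLeft_cases n X δ A B (k + 1) with ⟨_, e⟩ | ⟨_, _, e⟩
        · linarith [S.lower_le_cyclePos (by omega : k < 5 * n)]
        · rw [Nat.add_sub_cancel] at e
          linarith
    · constructor
      · rcases cycleRight_cases n X δ A B 0 with ⟨_, e⟩ | ⟨_, _, _⟩
        · linarith [S.cyclePos_le_upper hk]
        · omega
      · rcases cycleLeft_cases n X δ A B k' with ⟨_, e⟩ | ⟨_, _, _⟩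
        · linarith [S.lower_le_cyclePos (by omega : 0 < 5 * n)]
        · omega

end SeparatedIntervals

/-- Place of the cycle vertex `j` in the left-to-right order. -/
def cyclePlace (n j : ℕ) : ℕ := if j = 0 then 5 * n - 1 else j - 1

theorem cyclePlace_lt {n : ℕ} (j : Fin (5 * n)) : cyclePlace n j < 5 * n := by
  have := j.2
  unfold cyclePlace
  split_ifs <;> omega

theorem cyclePlace_injective (n : ℕ) : Function.Injective fun j : Fin (5 * n) => cyclePlace n j := by
  intro a b h
  have := a.2
  have := b.2
  ext
  simp only [cyclePlace] at h
  split_ifs at h <;> omega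

theorem succ_mod_eq_iff_s7 {N a b : ℕ} (ha : a < N) (hb : b < N) :
    (a + 1) % N = b ↔ b = a + 1 ∨ (b = 0 ∧ a + 1 = N) := by
  rcases (Nat.succ_le_of_lt ha).eq_or_lt with h | h
  · rw [show a + 1 = N from h, Nat.mod_self]
    omega
  · rw [Nat.mod_eq_of_lt h]
    omega

theorem cycle_adj_iff_cyclePlace {n : ℕ} (a b : Fin (5 * n)) (h : cyclePlace n a < cyclePlace n b) :
    ((a.val + 1) % (5 * n) = b.val ∨ (b.val + 1) % (5 * n) = a.val) ↔
      cyclePlace n b = cyclePlace n a + 1 ∨ (cyclePlace n a = 0 ∧ cyclePlace n b + 1 = 5 * n) := by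
  have ha := a.2
  have hb := b.2
  rw [succ_mod_eq_iff_s7 ha hb, succ_mod_eq_iff_s7 hb ha]
  simp only [cyclePlace] at h ⊢
  split_ifs at h ⊢ <;> omega

theorem exists_separatedIntervals {n : ℕ} (x l r : Fin n → ℝ) (hx : StrictMono x)
    (hl : ∀ i, l i < x i) (hr : ∀ i, x i < r i) :
    ∃ (X L U : ℕ → ℝ) (δ A B : ℝ), (∀ i : Fin n, X i = x i ∧ L i = l i ∧ U i = r i) ∧
      SeparatedIntervals n X L U δ A B := by
  let ext (f : Fin n → ℝ) (i : ℕ) : ℝ := if h : i < n then f ⟨i, h⟩ else 0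
  have hext : ∀ (f : Fin n → ℝ) (i : ℕ) (h : i < n), ext f i = f ⟨i, h⟩ := fun f i h => dif_pos h
  obtain ⟨a, ha, hal⟩ := exists_pos_forall_lt (fun i => x i - l i) fun i => sub_pos.2 (hl i)
  obtain ⟨b, hb, hbr⟩ := exists_pos_forall_lt (fun i => r i - x i) fun i => sub_pos.2 (hr i)
  obtain ⟨d, hd, hdx⟩ := exists_pos_forall_lt
    (fun e : {e : Fin n × Fin n // e.1 < e.2} => x e.1.2 - x e.1.1) fun e => sub_pos.2 (hx e.2)
  obtain ⟨A, hA⟩ := (Set.finite_range l).bddBelow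
  obtain ⟨B, hB⟩ := (Set.finite_range r).bddAbove
  obtain ⟨δ, hδ, h20⟩ : ∃ δ > 0, 20 * δ ≤ a ∧ 20 * δ ≤ b ∧ 20 * δ ≤ d := by
    refine ⟨min a (min b d) / 20, by positivity, ?_⟩
    rw [mul_div_cancel₀ _ (by norm_num)]
    simp
  refine ⟨ext x, ext l, ext r, δ, A - 2 * δ, B + 2 * δ,
    fun i => ⟨hext x i i.2, hext l i i.2, hext r i i.2⟩, hδ, ?_, ?_, ?_, ?_, ?_⟩
  · intro i hi
    have := hdx ⟨(⟨i, by omega⟩, ⟨i + 1, hi⟩), by simp⟩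
    simp only at this
    rw [hext x i (by omega), hext x _ hi]
    linarith
  · intro i hi
    have := hal ⟨i, hi⟩
    rw [hext x i hi, hext l i hi]
    linarith
  · intro i hi
    have := hbr ⟨i, hi⟩
    rw [hext x i hi, hext r i hi]
    linarith
  · intro i hi
    have := hA (Set.mem_range_self (⟨i, hi⟩ : Fin n))
    rw [hext l i hi]
    linarith
  · intro i hi
    have := hB (Set.mem_range_self (⟨i, hi⟩ : Fin n))
    rw [hext r i hi]
    linarith

/-- Every monotone L-representation (Mpt representation) of a graph
`G` on `Fin n` inducing the natural order can be extended (keeping the shapes of the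
original vertices) to a monotone L-representation of some cycle extension `H` of `G`. -/
theorem extend_mpt_to_cycle_extension (n : ℕ) (G : SimpleGraph (Fin n))
    (R : MptRep G) (hord : ∀ i j : Fin n, i < j ↔ R.p i < R.p j) :
    ∃ H : SimpleGraph (Fin n ⊕ Fin (5 * n)), IsCycleExtension n G H ∧
      ∃ R' : MptRep H, ∀ i : Fin n,
        R'.p (Sum.inl i) = R.p i ∧ R'.q (Sum.inl i) = R.q i ∧
        R'.ht (Sum.inl i) = R.ht i ∧ R'.wd (Sum.inl i) = R.wd i := by
  obtain ⟨m, c, hm, hq⟩ := R.line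
  have hl : ∀ i, R.p i + R.ht i / m < R.p i := fun i => by
    linarith [div_neg_of_pos_of_neg (R.ht_pos i) hm]
  have hr : ∀ i, R.p i < R.p i + R.wd i := fun i => by linarith [R.wd_pos i]
  obtain ⟨X, L, U, δ, A, B, hXLU, S⟩ := exists_separatedIntervals R.p
    (fun i => R.p i + R.ht i / m) (fun i => R.p i + R.wd i) (fun i j h => (hord i j).1 h) hl hr
  let p : Fin n ⊕ Fin (5 * n) → ℝ :=
    Sum.elim (fun i => X i) fun j => cyclePos n X δ A B (cyclePlace n j)
  let l : Fin n ⊕ Fin (5 * n) → ℝ :=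
    Sum.elim (fun i => L i) fun j => cycleLeft n X δ A B (cyclePlace n j)
  let r : Fin n ⊕ Fin (5 * n) → ℝ :=
    Sum.elim (fun i => U i) fun j => cycleRight n X δ A B (cyclePlace n j)
  have hX := fun i => (hXLU i).1
  have hL := fun i => (hXLU i).2.1
  have hU := fun i => (hXLU i).2.2
  have hlp : ∀ v, l v < p v := by
    rintro (i | j)
    · simpa only [l, p, Sum.elim_inl, hX, hL] using hl i
    · exact S.cycleLeft_lt (cyclePlace_lt j)
  have hpr : ∀ v, p v < r v := by
    rintro (i | j)
    · simpa only [r, p, Sum.elim_inl, hX, hU] using hr i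
    · exact S.lt_cycleRight (cyclePlace_lt j)
  have hp : Function.Injective p := by
    rintro (i | j) (i' | j') h <;> simp only [p, Sum.elim_inl, Sum.elim_inr] at h
    · rw [hX, hX] at h
      rw [R.p_inj h]
    · exact absurd h.symm (S.cyclePos_ne_center i.2 (cyclePlace_lt j'))
    · exact absurd h (S.cyclePos_ne_center i'.2 (cyclePlace_lt j))
    · rw [cyclePlace_injective n (S.cyclePos_injOn (cyclePlace_lt j) (cyclePlace_lt j') h)]
  have hleft : ∀ u v, p u < p v → l v = p u → ¬ p v ≤ r u := by
    rintro (i | j) (i' | j') h <;> simp only [p, l, r, Sum.elim_inl, Sum.elim_inr] at h ⊢ <;>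
      intro e h'
    · rw [hX, hX] at h
      rw [hL, hX] at e
      rw [hX, hU] at h'
      have hne : i ≠ i' := by rintro rfl; exact h.false
      have := (R.endpoints_off i i' hne).1
      rw [hq, hq, top_mem_MShape_iff hm (R.ht_pos i) (R.wd_pos i) h.ne] at this
      exact this ⟨h, e, h'⟩
    · exact S.cycleLeft_ne_center i.2 (cyclePlace_lt j') e
    · have hmem := S.near_of_center_mem i'.2 (cyclePlace_lt j)
        ((S.cycleLeft_lt (cyclePlace_lt j)).le.trans h.le) h'
      have := hlp (Sum.inl i')
      have := hpr (Sum.inl i')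
      simp only [p, l, r, Sum.elim_inl] at *
      rcases hmem with hk | hk | hk
      · rcases S.far_of_extreme i'.2 (Or.inl hk) <;> linarith
      · rcases S.far_of_extreme i'.2 (Or.inr hk) <;> linarith
      · linarith [(S.inside_of_near i'.2 hk).1]
    · exact S.cycleLeft_ne_cyclePos (cyclePlace_lt j') (cyclePlace_lt j) e
  have hright : ∀ u v, p u < p v → r u = p v → ¬ l v ≤ p u := by
    rintro (i | j) (i' | j') h <;> simp only [p, l, r, Sum.elim_inl, Sum.elim_inr] at h ⊢ <;>
      intro e h'
    · rw [hX, hX] at h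
      rw [hU, hX] at e
      rw [hL, hX] at h'
      have hne : i' ≠ i := by rintro rfl; exact h.false
      have := (R.endpoints_off i' i hne).2
      rw [hq, hq, right_mem_MShape_iff hm (R.ht_pos i') (R.wd_pos i') (R.wd_pos i) h.ne'] at this
      exact this ⟨h, e, h'⟩
    · have hmem := S.near_of_center_mem i.2 (cyclePlace_lt j') h'
        (h.le.trans (S.lt_cycleRight (cyclePlace_lt j')).le)
      have := hlp (Sum.inl i)
      have := hpr (Sum.inl i)
      simp only [p, l, r, Sum.elim_inl] at *
      rcases hmem with hk | hk | hk
      · rcases S.far_of_extreme i.2 (Or.inl hk) <;> linarith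
      · rcases S.far_of_extreme i.2 (Or.inr hk) <;> linarith
      · linarith [(S.inside_of_near i.2 hk).2]
    · exact S.cycleRight_ne_center i'.2 (cyclePlace_lt j) e
    · exact S.cycleRight_ne_cyclePos (cyclePlace_lt j) (cyclePlace_lt j') e
  have hxx : ∀ i i' : Fin n, i < i' →
      ((pointIntervalGraph p l r).Adj (Sum.inl i) (Sum.inl i') ↔ G.Adj i i') := by
    intro i i' h
    have hlt := (hord i i').1 h
    rw [pointIntervalGraph_adj_iff_of_lt hlp hpr (by simpa [p, hX] using hlt),
      R.adj_iff i i' h.ne, hq, hq, MShape_inter_nonempty_iff hm (R.ht_pos i) (R.wd_pos i)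
        (R.ht_pos i') (R.wd_pos i') hlt]
    simp only [p, l, r, Sum.elim_inl, hX, hL, hU]
  have hyy : ∀ j j' : Fin (5 * n), cyclePlace n j < cyclePlace n j' →
      ((pointIntervalGraph p l r).Adj (Sum.inr j) (Sum.inr j') ↔
        ((j.val + 1) % (5 * n) = j'.val ∨ (j'.val + 1) % (5 * n) = j.val)) := by
    intro j j' h
    have hlt := S.cyclePos_lt h (cyclePlace_lt j')
    have := S.pos
    rw [pointIntervalGraph_adj_iff_of_lt hlp hpr (by simp only [p, Sum.elim_inr]; linarith),
      cycle_adj_iff_cyclePlace j j' h]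
    exact S.cycle_adj_iff_of_lt h (cyclePlace_lt j')
  refine ⟨pointIntervalGraph p l r, ⟨?_, ?_, ?_⟩,
    pointIntervalRep c hm hp hlp hpr hleft hright, ?_⟩
  · intro i i'
    rcases lt_trichotomy i i' with h | rfl | h
    · exact hxx i i' h
    · simp
    · rw [SimpleGraph.adj_comm, G.adj_comm]
      exact hxx i' i h
  · intro j j'
    rcases lt_trichotomy (cyclePlace n j) (cyclePlace n j') with h | h | h
    · exact hyy j j' h
    · obtain rfl := cyclePlace_injective n h
      have := j.2
      rw [succ_mod_eq_iff_s7 this this]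
      simp only [SimpleGraph.irrefl, false_iff]
      omega
    · rw [SimpleGraph.adj_comm, or_comm]
      exact hyy j' j h
  · intro i
    right
    intro j
    have hj := j.2
    have hi := i.2
    have : (pointIntervalGraph p l r).Adj (Sum.inl i) (Sum.inr j) ↔
        cyclePlace n j = 5 * i + 2 ∨ cyclePlace n j = 5 * i + 3 := by
      rw [← S.center_adj_iff i.2 (cyclePlace_lt j)]
      exact ⟨fun h => h.2, fun h => ⟨Sum.inl_ne_inr, h⟩⟩
    rw [this]
    unfold cyclePlace
    split_ifs <;> omega
  · intro i
    refine ⟨hX i, ?_, ?_, ?_⟩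
    · simp only [pointIntervalRep, p, Sum.elim_inl, hX, hq]
    · simp only [pointIntervalRep, p, l, Sum.elim_inl, hX, hL, add_sub_cancel_left]
      exact mul_div_cancel₀ _ hm.ne
    · simp only [pointIntervalRep, p, r, Sum.elim_inl, hX, hU, add_sub_cancel_left]
end
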